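/- arXiv:1809.10371 — 4 statements merged into one kernel-verified Lean document; each statement's English description precedes it below -/
import Mathlib

section
/- Let D ⊆ ℂⁿ be a domain, let φ : D → [-∞, +∞) be upper semicontinuous and not identically -∞, and fix a constant p > 0. Suppose there are constants C_m > 0, independent of the point, with (1/m)·log C_m → 0 as m → ∞, such that for every z₀ ∈ D with φ(z₀) > -∞ and every positive integer m there exists a holomorphic function f on D with f(z₀) = 1 and ∫_D |f|^p e^{-mφ} dλ ≤ C_m e^{-mφ(z₀)}. Then φ is plurisubharmonic on D. -/
open MeasureTheory Complex Set
open scoped ENNReal NNReal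

noncomputable section

/-- `e^x` as a map `EReal → ℝ≥0∞` (`e^{-∞} = 0`, `e^{+∞} = ∞`). -/
def expE (x : EReal) : ℝ≥0∞ := EReal.exp x

/-- `log` as a map `ℝ≥0∞ → EReal`. -/
def logE (x : ℝ≥0∞) : EReal := ENNReal.log x

/-- Truncation of an extended real to `ℝ≥0∞`. -/
def toENN (x : EReal) : ℝ≥0∞ := if x = ⊤ then ⊤ else ENNReal.ofReal x.toReal

/-- The point `c + r·e^{iθ}` on the circle of center `c` and radius `r`. -/
def cpt (c : ℂ) (r θ : ℝ) : ℂ := c + r * Complex.exp (θ * Complex.I)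

/-- The averaged "deficit" `M - (circle mean of u)` over the circle of center `c`, radius `r`,
for an upper bound `M` of `u` on that circle. -/
def circleDeficit (u : ℂ → EReal) (c : ℂ) (r M : ℝ) : ℝ≥0∞ :=
  (∫⁻ θ in Set.Ioc 0 (2 * Real.pi), toENN ((M : EReal) - u (cpt c r θ))) /
    ENNReal.ofReal (2 * Real.pi)

/-- Sub-mean value inequality for `u` at the circle of center `c` and radius `r`:
`u c ≤ (circle mean of u)`, expressed as `u c + (M - mean) ≤ M` for every
upper bound `M` of `u` on the circle. -/
def SubmeanAt (u : ℂ → EReal) (c : ℂ) (r : ℝ) : Prop :=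
  ∀ M : ℝ, (∀ θ : ℝ, u (cpt c r θ) ≤ (M : EReal)) →
    u c + ((circleDeficit u c r M : ℝ≥0∞) : EReal) ≤ (M : EReal)

/-- A function `u : ℂ → EReal` is subharmonic on a set `S` if it is upper semicontinuous on `S`
and satisfies the sub-mean value inequality on every closed disc contained in `S`. -/
def SubharmonicOn (u : ℂ → EReal) (S : Set ℂ) : Prop :=
  UpperSemicontinuousOn u S ∧
    ∀ c r, 0 < r → Metric.closedBall c r ⊆ S → SubmeanAt u c r

/-- A function with values in `[-∞, +∞)` is plurisubharmonic on `D` if it is upper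
semicontinuous on `D` and its restriction to every complex line is subharmonic. -/
def PlurisubharmonicOn {E : Type*} [NormedAddCommGroup E] [NormedSpace ℂ E]
    (φ : E → EReal) (D : Set E) : Prop :=
  UpperSemicontinuousOn φ D ∧
    ∀ a b : E, SubharmonicOn (fun w : ℂ => φ (a + w • b)) {w : ℂ | a + w • b ∈ D}

/-- A set is a pseudoconvex domain if it is open, connected and admits a continuous
plurisubharmonic exhaustion function. -/
def IsPseudoconvexDomain {E : Type*} [NormedAddCommGroup E] [NormedSpace ℂ E]
    (Ω : Set E) : Prop :=
  IsOpen Ω ∧ IsConnected Ω ∧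
    ∃ ρ : E → ℝ, ContinuousOn ρ Ω ∧ PlurisubharmonicOn (fun z => (ρ z : EReal)) Ω ∧
      ∀ c : ℝ, IsCompact {z ∈ Ω | ρ z ≤ c}

/-- Jensen: the circle mean of `log |F|` is nonnegative when `F c = 1`; hence the same
for any majorant (away from the zeros of `F`). -/
lemma jensen_majorant {F : ℂ → ℂ} {c : ℂ} {R : ℝ} (hR : 0 < R)
    (hF : AnalyticOnNhd ℂ F (Metric.closedBall c R)) (hFc : F c = 1)
    {G : ℝ → ℝ} (hG : IntervalIntegrable G volume 0 (2 * Real.pi))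
    (hle : ∀ θ ∈ Set.Ioc 0 (2 * Real.pi), F (circleMap c R θ) ≠ 0 →
      Real.log ‖F (circleMap c R θ)‖ ≤ G θ) :
    0 ≤ ∫ θ in (0:ℝ)..(2 * Real.pi), G θ := by
  have hRabs : |R| = R := abs_of_pos hR
  have hF' : AnalyticOnNhd ℂ F (Metric.closedBall c |R|) := by rwa [hRabs]
  have hj := hF'.circleAverage_log_norm hR.ne' (by rw [hFc]; exact one_ne_zero)
  have h0 : 0 ≤ Real.circleAverage (Real.log ‖F ·‖) c R := by
    rw [hj, hFc, norm_one, Real.log_one, add_zero]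
    apply finsum_nonneg
    intro u
    by_cases hu : u ∈ Metric.closedBall c |R|
    · apply mul_nonneg
      · exact_mod_cast (MeromorphicOn.AnalyticOnNhd.divisor_nonneg hF') u
      · rcases eq_or_ne u c with rfl | huc
        · simp
        apply Real.log_nonneg
        have : 0 < ‖c - u‖ := by
          rw [norm_pos_iff, sub_ne_zero]; exact huc.symm
        rw [← div_eq_mul_inv, one_le_div this, norm_sub_rev, ← dist_eq_norm]
        simpa [hRabs] using hu
    · rw [Function.locallyFinsuppWithin.apply_eq_zero_of_notMem _ hu]; simp
  have hint : IntervalIntegrable (fun θ => Real.log ‖F (circleMap c R θ)‖) volume 0 (2 * Real.pi) :=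
    (hF'.mono Metric.sphere_subset_closedBall).meromorphicOn.circleIntegrable_log_norm
  have h1 : 0 ≤ ∫ θ in (0:ℝ)..(2 * Real.pi), Real.log ‖F (circleMap c R θ)‖ := by
    rw [Real.circleAverage_def, smul_eq_mul] at h0
    have : 0 < (2 * Real.pi)⁻¹ := by positivity
    exact nonneg_of_mul_nonneg_right h0 this
  refine h1.trans ?_
  have hcod : F ⁻¹' {0}ᶜ ∈ Filter.codiscreteWithin (Metric.closedBall c |R|) := by
    apply hF'.preimage_zero_mem_codiscreteWithin (x := c)
    · rw [hFc]; exact one_ne_zero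
    · simp
    · exact (convex_closedBall _ _).isConnected ⟨c, by simp⟩
  have hcod2 := Filter.codiscreteWithin_mono Metric.sphere_subset_closedBall hcod
  have hcod3 := circleMap_preimage_codiscrete hR.ne' hcod2
  have hae := ae_restrict_le_codiscreteWithin (measurableSet_Ioc (a := (0:ℝ)) (b := 2 * Real.pi))
    (μ := volume) (Filter.codiscreteWithin_mono (subset_univ _) hcod3)
  apply intervalIntegral.integral_mono_ae_restrict (by positivity) hint hG
  rw [Filter.EventuallyLE, ← restrict_Ioc_eq_restrict_Icc, ae_restrict_iff' measurableSet_Ioc]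
  have := (ae_restrict_iff' (measurableSet_Ioc (a := (0:ℝ)) (b := 2 * Real.pi))).1 hae
  filter_upwards [this] with θ h hθ
  exact hle θ hθ (h hθ)

/-- One-dimensional sub-mean value inequality for `|F|^p`. -/
lemma submean_rpow {F : ℂ → ℂ} (hF : AnalyticOnNhd ℂ F (Metric.closedBall 0 1)) {p : ℝ}
    (hp : 0 < p) :
    ENNReal.ofReal (2 * Real.pi) * (‖F 0‖₊ : ℝ≥0∞) ^ p ≤
      ∫⁻ θ in Set.Ioc 0 (2 * Real.pi), (‖F (circleMap 0 1 θ)‖₊ : ℝ≥0∞) ^ p := by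
  by_cases h0 : F 0 = 0
  · simp [h0, hp]
  have hcont : Continuous fun θ : ℝ => F (circleMap 0 1 θ) := by
    have := hF.continuousOn.comp_continuous (continuous_circleMap 0 1)
      (fun θ => circleMap_mem_closedBall 0 zero_le_one θ)
    exact this
  have hcont2 : Continuous fun θ : ℝ => ‖F (circleMap 0 1 θ)‖ ^ p :=
    hcont.norm.rpow_const (fun _ => Or.inr hp.le)
  have hB : 0 < ‖F 0‖ := norm_pos_iff.2 h0
  have hBp : 0 < ‖F 0‖ ^ p := Real.rpow_pos_of_pos hB p
  have key := jensen_majorant (F := fun w => (F 0)⁻¹ * F w) one_pos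
    (analyticOnNhd_const.mul hF) (by simp [h0])
    (G := fun θ => ((‖F 0‖ ^ p)⁻¹ * ‖F (circleMap 0 1 θ)‖ ^ p - 1) / p)
    (Continuous.intervalIntegrable (by fun_prop) _ _)
    (by
      intro θ _ hne
      rw [le_div_iff₀ hp, norm_mul, norm_inv]
      have hpos : 0 < ‖F 0‖⁻¹ * ‖F (circleMap 0 1 θ)‖ := by
        rw [← norm_inv, ← norm_mul]; exact norm_pos_iff.2 hne
      rw [mul_comm, ← Real.log_rpow hpos, ← Real.inv_rpow hB.le,
        ← Real.mul_rpow (by positivity) (by positivity)]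
      exact Real.log_le_sub_one_of_pos (Real.rpow_pos_of_pos hpos p))
  rw [intervalIntegral.integral_div, intervalIntegral.integral_sub
    (Continuous.intervalIntegrable (by fun_prop) _ _) (by simp),
    intervalIntegral.integral_const_mul] at key
  have key2 : 2 * Real.pi * ‖F 0‖ ^ p ≤ ∫ θ in (0:ℝ)..(2 * Real.pi), ‖F (circleMap 0 1 θ)‖ ^ p := by
    have := mul_nonneg key hp.le
    rw [div_mul_cancel₀ _ hp.ne'] at this
    simp only [intervalIntegral.integral_const, sub_zero, smul_eq_mul, mul_one] at this
    rw [sub_nonneg, inv_mul_eq_div, le_div_iff₀ hBp] at this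
    exact this
  have e1 : ∀ z : ℂ, (‖z‖₊ : ℝ≥0∞) ^ p = ENNReal.ofReal (‖z‖ ^ p) := by
    intro z
    rw [← ENNReal.ofReal_rpow_of_nonneg (norm_nonneg z) hp.le, ofReal_norm]; rfl
  simp only [e1]
  rw [← ENNReal.ofReal_mul (by positivity), ← ofReal_integral_eq_lintegral_ofReal
    (hcont2.integrableOn_Ioc) (Filter.Eventually.of_forall fun θ => by positivity),
    ← intervalIntegral.integral_of_le (by positivity)]
  exact ENNReal.ofReal_le_ofReal key2

/-- Sub-mean value inequality for `|f|^p` on sup-norm balls of `ℂⁿ`. -/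
lemma submean_ball {n : ℕ} {D : Set (Fin n → ℂ)} (hD : IsOpen D) {f : (Fin n → ℂ) → ℂ}
    (hf : DifferentiableOn ℂ f D) {p : ℝ} (hp : 0 < p) {z : Fin n → ℂ} {δ : ℝ}
    (hz : Metric.ball z δ ⊆ D) :
    (‖f z‖₊ : ℝ≥0∞) ^ p * volume (Metric.ball (0 : Fin n → ℂ) δ) ≤
      ∫⁻ w in Metric.ball z δ, (‖f w‖₊ : ℝ≥0∞) ^ p := by
  set B := Metric.ball (0 : Fin n → ℂ) δ with hBdef
  set g : (Fin n → ℂ) → ℝ≥0∞ := fun w => (‖f w‖₊ : ℝ≥0∞) ^ p with hg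
  have hmemB : ∀ v ∈ B, z + v ∈ Metric.ball z δ := by
    intro v hv
    simpa [hBdef, dist_eq_norm] using hv
  have hI : ∫⁻ w in Metric.ball z δ, g w = ∫⁻ v in B, g (z + v) := by
    have hmp := measurePreserving_add_left (volume : Measure (Fin n → ℂ)) z
    have := hmp.setLIntegral_comp_preimage_emb (MeasurableEquiv.addLeft z).measurableEmbedding g
      (Metric.ball z δ)
    rw [← this]
    congr 2
    ext v
    simp [hBdef, dist_eq_norm]
  have hrot : ∀ θ : ℝ, ∫⁻ v in B, g (z + circleMap 0 1 θ • v) = ∫⁻ v in B, g (z + v) := by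
    intro θ
    have hnorm : ‖circleMap 0 1 θ‖ = 1 := by simp
    let u : Circle := ⟨circleMap 0 1 θ, by simp [Submonoid.unitSphere]⟩
    have hmp : MeasurePreserving (fun v : Fin n → ℂ => fun i => rotation u (v i)) :=
      volume_preserving_pi (fun _ => (rotation u).measurePreserving)
    have hemb : MeasurableEmbedding (fun v : Fin n → ℂ => fun i => rotation u (v i)) :=
      (MeasurableEquiv.piCongrRight
        (fun _ : Fin n => (rotation u).toMeasurableEquiv)).measurableEmbedding
    have := hmp.setLIntegral_comp_preimage_emb hemb (fun v => g (z + v)) B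
    rw [← this]
    have hfun : (fun v : Fin n → ℂ => fun i => rotation u (v i)) =
        fun v => circleMap 0 1 θ • v := by
      ext v i; rfl
    rw [hfun]
    congr 2
    ext v
    simp [hBdef, norm_smul]
  have hgcont : ContinuousOn g D := by
    have : ContinuousOn (fun w => (‖f w‖₊ : ℝ≥0∞)) D :=
      ENNReal.continuous_coe.comp_continuousOn hf.continuousOn.nnnorm
    exact (ENNReal.continuous_rpow_const).comp_continuousOn this
  have hmemB2 : ∀ v ∈ B, ∀ t ∈ Metric.closedBall (0:ℂ) 1, z + t • v ∈ D := by
    intro v hv t ht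
    apply hz; apply hmemB
    simp only [hBdef, mem_ball_zero_iff, mem_closedBall_zero_iff, norm_smul] at *
    nlinarith [norm_nonneg v, norm_nonneg t]
  have hswap : ∫⁻ θ in Set.Ioc 0 (2 * Real.pi), ∫⁻ v in B, g (z + circleMap 0 1 θ • v) =
      ∫⁻ v in B, ∫⁻ θ in Set.Ioc 0 (2 * Real.pi), g (z + circleMap 0 1 θ • v) := by
    apply lintegral_lintegral_swap
    rw [Measure.prod_restrict]
    apply ContinuousOn.aemeasurable _ (measurableSet_Ioc.prod Metric.isOpen_ball.measurableSet)
    apply hgcont.comp (f := fun q : ℝ × (Fin n → ℂ) => z + circleMap 0 1 q.1 • q.2)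
    · have : Continuous (circleMap 0 1) := continuous_circleMap 0 1
      exact Continuous.continuousOn (by fun_prop)
    · rintro ⟨θ, v⟩ ⟨_, hv⟩
      exact hmemB2 v hv _ (circleMap_mem_closedBall 0 zero_le_one θ)
  have hlow : ∀ v ∈ B, ENNReal.ofReal (2 * Real.pi) * g z ≤
      ∫⁻ θ in Set.Ioc 0 (2 * Real.pi), g (z + circleMap 0 1 θ • v) := by
    intro v hv
    have hopen : IsOpen ((fun t : ℂ => z + t • v) ⁻¹' D) := hD.preimage (by fun_prop)
    have hdiff : DifferentiableOn ℂ (fun t : ℂ => f (z + t • v)) ((fun t : ℂ => z + t • v) ⁻¹' D) :=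
      hf.comp (f := fun t : ℂ => z + t • v)
        (Differentiable.differentiableOn (by fun_prop)) (fun _ h => h)
    have han := (hdiff.analyticOnNhd hopen).mono (fun t ht => hmemB2 v hv t ht)
    simpa [hg] using submean_rpow han hp
  have h2pi : ENNReal.ofReal (2 * Real.pi) ≠ 0 := by
    simp [Real.pi_pos]
  have hfin : ENNReal.ofReal (2 * Real.pi) * (g z * volume B) ≤
      ENNReal.ofReal (2 * Real.pi) * ∫⁻ v in B, g (z + v) := by
    calc ENNReal.ofReal (2 * Real.pi) * (g z * volume B)
        = ∫⁻ v in B, ENNReal.ofReal (2 * Real.pi) * g z := by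
          rw [setLIntegral_const]; ring
      _ ≤ ∫⁻ v in B, ∫⁻ θ in Set.Ioc 0 (2 * Real.pi), g (z + circleMap 0 1 θ • v) :=
          setLIntegral_mono' Metric.isOpen_ball.measurableSet hlow
      _ = ∫⁻ θ in Set.Ioc 0 (2 * Real.pi), ∫⁻ v in B, g (z + v) := by
          rw [← hswap]; simp only [hrot]
      _ = _ := by rw [setLIntegral_const, Real.volume_Ioc, sub_zero, mul_comm]
  rw [hI]
  exact (ENNReal.mul_le_mul_iff_right h2pi ENNReal.ofReal_ne_top).1 hfin

/-- A lower semicontinuous function on `[0, 2π]` has integral at most `B` as soon as all its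
continuous nonnegative minorants do. -/
lemma lintegral_le_of_minorants {T : ℝ} (hT : 0 < T) (H : ℝ → ℝ≥0∞) (B : ℝ≥0∞)
    (hH : ∀ θ ∈ Set.Icc 0 T, ∀ s : ℝ, 0 ≤ s → ENNReal.ofReal s < H θ →
      ∀ᶠ t in nhdsWithin θ (Set.Icc 0 T), ENNReal.ofReal s < H t)
    (h : ∀ g : ℝ → ℝ, Continuous g → (∀ θ, 0 ≤ g θ) →
      (∀ θ ∈ Set.Icc 0 T, ENNReal.ofReal (g θ) ≤ H θ) →
      ∫⁻ θ in Set.Ioc 0 T, ENNReal.ofReal (g θ) ≤ B) :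
    ∫⁻ θ in Set.Ioc 0 T, H θ ≤ B := by
  have : Nonempty (Set.Icc 0 T) := ⟨⟨0, by simp [hT.le]⟩⟩
  let a : ℕ → ℝ → ℝ := fun k t => (min (H t) (k : ℝ≥0∞)).toReal
  let g : ℕ → ℝ → ℝ := fun k θ => ⨅ t : Set.Icc 0 T, (a k t + k * |θ - (t : ℝ)|)
  have ha0 : ∀ k t, 0 ≤ a k t := fun k t => ENNReal.toReal_nonneg
  have hnn : ∀ (k : ℕ) (θ : ℝ) (t : Set.Icc 0 T), 0 ≤ a k t + k * |θ - (t : ℝ)| := fun k θ t =>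
    add_nonneg (ha0 k t) (by positivity)
  have hbdd : ∀ (k : ℕ) (θ : ℝ),
      BddBelow (Set.range fun t : Set.Icc 0 T => a k t + k * |θ - (t : ℝ)|) := by
    intro k θ
    refine ⟨0, ?_⟩
    rintro _ ⟨t, rfl⟩
    exact hnn k θ t
  have hminne : ∀ (k : ℕ) (t : ℝ), min (H t) (k : ℝ≥0∞) ≠ ⊤ := fun k t =>
    ne_top_of_le_ne_top (ENNReal.natCast_ne_top k) (min_le_right _ _)
  have hg0 : ∀ k θ, 0 ≤ g k θ := fun k θ => Real.iInf_nonneg (hnn k θ)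
  have hgc : ∀ k, Continuous (g k) := by
    intro k
    have : LipschitzWith (k : ℝ≥0) (g k) := by
      apply LipschitzWith.of_le_add_mul
      intro x y
      rw [← sub_le_iff_le_add]
      apply le_ciInf
      intro t
      rw [sub_le_iff_le_add]
      refine (ciInf_le (hbdd k x) t).trans ?_
      have h1 : |x - t| ≤ |y - t| + dist x y := by
        rw [Real.dist_eq]
        have := abs_sub_le x y t
        linarith
      have h2 : (k:ℝ) * |x - t| ≤ k * (|y - t| + dist x y) := by gcongr
      simp only [NNReal.coe_natCast]
      linarith
    exact this.continuous
  have hgH : ∀ k, ∀ θ ∈ Set.Icc 0 T, ENNReal.ofReal (g k θ) ≤ H θ := by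
    intro k θ hθ
    have h1 : g k θ ≤ a k θ := by
      have := ciInf_le (hbdd k θ) ⟨θ, hθ⟩
      simpa using this
    refine (ENNReal.ofReal_le_ofReal h1).trans ?_
    rw [ENNReal.ofReal_toReal (hminne k θ)]
    exact min_le_left _ _
  have hlim : ∀ θ ∈ Set.Ioc 0 T, H θ ≤ Filter.liminf (fun k => ENNReal.ofReal (g k θ)) Filter.atTop := by
    intro θ hθ
    have hθ' : θ ∈ Set.Icc 0 T := Set.Ioc_subset_Icc_self hθ
    apply le_of_forall_lt
    intro y hy
    obtain ⟨y', hyy', hy'⟩ := exists_between hy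
    lift y' to ℝ≥0 using hy'.ne_top
    refine hyy'.trans_le ?_
    apply Filter.le_liminf_of_le
    · isBoundedDefault
    have hs : ENNReal.ofReal (y' : ℝ) = (y' : ℝ≥0∞) := ENNReal.ofReal_coe_nnreal
    have hev := hH θ hθ' y' y'.2 (by rw [hs]; exact hy')
    rw [eventually_nhdsWithin_iff, Metric.eventually_nhds_iff] at hev
    obtain ⟨η, hη, hev⟩ := hev
    obtain ⟨K, hK⟩ := exists_nat_ge (max (y' : ℝ) (y' / η))
    filter_upwards [Filter.eventually_ge_atTop K] with k hk
    have hkK : (K : ℝ) ≤ k := by exact_mod_cast hk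
    have hk1 : (y' : ℝ) ≤ k := (le_max_left _ _).trans (hK.trans hkK)
    have hk2 : (y' : ℝ) / η ≤ k := (le_max_right _ _).trans (hK.trans hkK)
    rw [← hs]
    apply ENNReal.ofReal_le_ofReal
    apply le_ciInf
    intro t
    by_cases htθ : dist (t : ℝ) θ < η
    · have h1 := hev htθ t.2
      rw [hs] at h1
      have : (y' : ℝ) ≤ a k t := by
        have h2 : (y' : ℝ≥0∞) ≤ min (H t) k := by
          refine le_min h1.le ?_
          have : y' ≤ (k : ℝ≥0) := by exact_mod_cast hk1
          exact_mod_cast this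
        have := ENNReal.toReal_mono (hminne k t) h2
        simpa using this
      have h3 : 0 ≤ (k:ℝ) * |θ - t| := by positivity
      linarith
    · have h1 : η ≤ |θ - t| := by
        rw [← Real.dist_eq, dist_comm]; exact not_lt.1 htθ
      have h2 : (y' : ℝ) ≤ k * η := (div_le_iff₀ hη).1 hk2
      have h3 : (k:ℝ) * η ≤ k * |θ - t| := by gcongr
      linarith [ha0 k t]
  calc ∫⁻ θ in Set.Ioc 0 T, H θ
      ≤ ∫⁻ θ in Set.Ioc 0 T, Filter.liminf (fun k => ENNReal.ofReal (g k θ)) Filter.atTop :=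
        setLIntegral_mono' measurableSet_Ioc hlim
    _ ≤ Filter.liminf (fun k => ∫⁻ θ in Set.Ioc 0 T, ENNReal.ofReal (g k θ)) Filter.atTop :=
        lintegral_liminf_le (fun k => ((hgc k).measurable).ennreal_ofReal)
    _ ≤ B := by
        apply Filter.liminf_le_of_frequently_le'
        exact Filter.Frequently.of_forall fun k => h (g k) (hgc k) (hg0 k) (hgH k)

lemma lt_toENN_iff (M s : ℝ) (hs : 0 ≤ s) (e : EReal) (he : e ≠ ⊤) :
    ENNReal.ofReal s < toENN ((M : EReal) - e) ↔ e < ((M - s : ℝ) : EReal) := by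
  induction e with
  | bot =>
    have : (M : EReal) - ⊥ = ⊤ := rfl
    simp only [toENN, this, if_true]
    exact ⟨fun _ => EReal.bot_lt_coe _, fun _ => ENNReal.ofReal_lt_top⟩
  | top => exact absurd rfl he
  | coe e =>
    rw [← EReal.coe_sub]
    simp only [toENN, EReal.coe_ne_top, if_false, EReal.toReal_coe, EReal.coe_lt_coe_iff]
    rw [ENNReal.ofReal_lt_ofReal_iff_of_nonneg hs]
    constructor <;> intro h <;> linarith

lemma lt_of_le_toENN (M s ε : ℝ) (hε : 0 < ε) (e : EReal) (he : e ≤ M)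
    (h : ENNReal.ofReal s ≤ toENN ((M : EReal) - e)) : e < ((M - s + ε : ℝ) : EReal) := by
  induction e with
  | bot => exact EReal.bot_lt_coe _
  | top => simp at he
  | coe e =>
    rw [← EReal.coe_sub] at h
    simp only [toENN, EReal.coe_ne_top, if_false, EReal.toReal_coe] at h
    rw [EReal.coe_lt_coe_iff]
    rw [EReal.coe_le_coe_iff] at he
    rw [ENNReal.ofReal_le_ofReal_iff (by linarith)] at h
    linarith

/-- The main estimate: `φ(z₀)` is at most the circle mean of any continuous strict majorant. -/
lemma le_mean_majorant {n : ℕ} (D : Set (Fin n → ℂ)) (hDopen : IsOpen D)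
    (φ : (Fin n → ℂ) → EReal) (hφ_usc : UpperSemicontinuousOn φ D)
    (p : ℝ) (hp : 0 < p)
    (C : ℕ → ℝ) (hCpos : ∀ m, 0 < C m)
    (hCgrowth : Filter.Tendsto (fun m : ℕ => Real.log (C m) / (m : ℝ)) Filter.atTop (nhds 0))
    (hext : ∀ z₀ ∈ D, φ z₀ ≠ ⊥ → ∀ m : ℕ, 0 < m →
      ∃ f : (Fin n → ℂ) → ℂ, DifferentiableOn ℂ f D ∧ f z₀ = 1 ∧
        (∫⁻ z in D, (‖f z‖₊ : ℝ≥0∞) ^ p * expE (-((m : ℝ) : EReal) * φ z)) ≤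
          ENNReal.ofReal (C m) * expE (-((m : ℝ) : EReal) * φ z₀))
    (a b : Fin n → ℂ) (c : ℂ) (r : ℝ) (hr : 0 < r)
    (hball : Metric.closedBall c r ⊆ {w : ℂ | a + w • b ∈ D})
    (x : ℝ) (hx : φ (a + c • b) = x)
    (g : ℝ → ℝ) (hg : Continuous g)
    (hφg : ∀ θ ∈ Set.Icc 0 (2 * Real.pi), φ (a + circleMap c r θ • b) < g θ) :
    2 * Real.pi * x ≤ ∫ θ in (0:ℝ)..(2 * Real.pi), g θ := by
  have hcm : Continuous (circleMap c r) := continuous_circleMap c r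
  have hpt : Continuous fun θ : ℝ => a + circleMap c r θ • b := by fun_prop
  have hinD : ∀ θ, a + circleMap c r θ • b ∈ D := fun θ =>
    hball (circleMap_mem_closedBall c hr.le θ)
  -- a uniform radius
  obtain ⟨δ, hδ, hδ'⟩ : ∃ δ > 0, ∀ θ ∈ Set.Icc 0 (2 * Real.pi), ∀ v : Fin n → ℂ, ‖v‖ < δ →
      a + circleMap c r θ • b + v ∈ D ∧ φ (a + circleMap c r θ • b + v) < g θ := by
    have hev : ∀ θ ∈ Set.Icc 0 (2 * Real.pi),
        ∀ᶠ q : (Fin n → ℂ) × ℝ in nhds (0, θ),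
          a + circleMap c r q.2 • b + q.1 ∈ D ∧ φ (a + circleMap c r q.2 • b + q.1) < g q.2 := by
      intro θ hθ
      have hcont : ContinuousAt (fun q : (Fin n → ℂ) × ℝ => a + circleMap c r q.2 • b + q.1)
          (0, θ) := Continuous.continuousAt (by fun_prop)
      obtain ⟨y, hy1, hy2⟩ := EReal.lt_iff_exists_real_btwn.1 (hφg θ hθ)
      have h1 : ∀ᶠ z in nhds (a + circleMap c r θ • b), φ z < y := by
        have := hφ_usc _ (hinD θ) y hy1
        rwa [hDopen.nhdsWithin_eq (hinD θ)] at this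
      have h2 : ∀ᶠ z in nhds (a + circleMap c r θ • b), z ∈ D := hDopen.mem_nhds (hinD θ)
      have h3 : ∀ᶠ q : (Fin n → ℂ) × ℝ in nhds (0, θ), y < g q.2 := by
        have : ContinuousAt (fun q : (Fin n → ℂ) × ℝ => g q.2) (0, θ) :=
          Continuous.continuousAt (by fun_prop)
        exact this.eventually (lt_mem_nhds (EReal.coe_lt_coe_iff.1 hy2))
      have h1' := hcont.tendsto.eventually (by simpa using h1)
      have h2' := hcont.tendsto.eventually (p := fun z => z ∈ D) (by simpa using h2)
      filter_upwards [h1', h2', h3] with q hq1 hq2 hq3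
      exact ⟨hq2, hq1.trans (EReal.coe_lt_coe_iff.2 hq3)⟩
    have := isCompact_Icc.eventually_forall_of_forall_eventually
      (P := fun (v : Fin n → ℂ) (θ : ℝ) =>
        a + circleMap c r θ • b + v ∈ D ∧ φ (a + circleMap c r θ • b + v) < g θ)
      (x₀ := (0 : Fin n → ℂ)) hev
    rw [Metric.eventually_nhds_iff] at this
    obtain ⟨δ, hδ, h⟩ := this
    exact ⟨δ, hδ, fun θ hθ v hv => h (by simpa using hv) θ hθ⟩
  set V := volume (Metric.ball (0 : Fin n → ℂ) δ) with hV
  have hV0 : V ≠ 0 := (Metric.measure_ball_pos _ _ hδ).ne'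
  have hVt : V ≠ ⊤ := measure_ball_lt_top.ne
  have hVpos : 0 < V.toReal := ENNReal.toReal_pos hV0 hVt
  have hz0 : a + c • b ∈ D := hball (Metric.mem_closedBall_self hr.le)
  have hgi : IntervalIntegrable g volume 0 (2 * Real.pi) := hg.intervalIntegrable _ _
  -- estimate for fixed `m`
  have main : ∀ m : ℕ, 0 < m → 2 * Real.pi * x ≤ (∫ θ in (0:ℝ)..(2 * Real.pi), g θ) +
      2 * Real.pi * (Real.log (C m) / m - Real.log V.toReal / m) := by
    intro m hm
    have hm' : (0:ℝ) < m := by exact_mod_cast hm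
    obtain ⟨f, hfd, hf1, hfint⟩ := hext _ hz0 (by rw [hx]; exact EReal.coe_ne_bot x) m hm
    have hexp : ∀ y : ℝ, expE (-((m : ℝ) : EReal) * (y : EReal)) =
        ENNReal.ofReal (Real.exp (-m * y)) := by
      intro y
      rw [← EReal.coe_neg, ← EReal.coe_mul]
      exact EReal.exp_coe _
    rw [hx, hexp] at hfint
    have hopen : IsOpen ((fun t : ℂ => a + t • b) ⁻¹' D) := hDopen.preimage (by fun_prop)
    have hdiff : DifferentiableOn ℂ (fun t : ℂ => f (a + t • b)) ((fun t : ℂ => a + t • b) ⁻¹' D) :=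
      hfd.comp (f := fun t : ℂ => a + t • b)
        (Differentiable.differentiableOn (by fun_prop)) (fun _ h => h)
    have han := (hdiff.analyticOnNhd hopen).mono hball
    have key := jensen_majorant hr han hf1
      (G := fun θ => (m * (g θ - x) + Real.log (C m) - Real.log V.toReal) / p)
      (Continuous.intervalIntegrable (by fun_prop) _ _)
      (by
        intro θ hθ hne
        have hθ' := Set.Ioc_subset_Icc_self hθ
        set z := a + circleMap c r θ • b with hz
        have hball' : ∀ w ∈ Metric.ball z δ, w ∈ D ∧ φ w < g θ := by
          intro w hw
          have := hδ' θ hθ' (w - z) (by simpa [dist_eq_norm] using hw)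
          simpa [← hz] using this
        have hs := submean_ball hDopen hfd hp (fun w hw => (hball' w hw).1)
        have hpt : ∀ w ∈ Metric.ball z δ, (‖f w‖₊ : ℝ≥0∞) ^ p ≤
            ENNReal.ofReal (Real.exp (m * g θ)) *
              ((‖f w‖₊ : ℝ≥0∞) ^ p * expE (-((m : ℝ) : EReal) * φ w)) := by
          intro w hw
          have h1 : ENNReal.ofReal (Real.exp (-m * g θ)) ≤ expE (-((m : ℝ) : EReal) * φ w) := by
            rw [← hexp]
            apply EReal.exp_monotone
            rw [neg_mul, neg_mul, EReal.neg_le_neg_iff]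
            exact mul_le_mul_of_nonneg_left (hball' w hw).2.le (EReal.coe_nonneg.2 hm'.le)
          calc (‖f w‖₊ : ℝ≥0∞) ^ p
              = ENNReal.ofReal (Real.exp (m * g θ)) *
                ((‖f w‖₊ : ℝ≥0∞) ^ p * ENNReal.ofReal (Real.exp (-m * g θ))) := by
                rw [mul_comm ((‖f w‖₊ : ℝ≥0∞) ^ p), ← mul_assoc,
                  ← ENNReal.ofReal_mul (Real.exp_nonneg _), ← Real.exp_add]
                simp
            _ ≤ _ := by gcongr
        have hchain : (‖f z‖₊ : ℝ≥0∞) ^ p * V ≤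
            ENNReal.ofReal (Real.exp (m * g θ) * (C m * Real.exp (-m * x))) := by
          calc (‖f z‖₊ : ℝ≥0∞) ^ p * V ≤ ∫⁻ w in Metric.ball z δ, (‖f w‖₊ : ℝ≥0∞) ^ p := hs
            _ ≤ ∫⁻ w in Metric.ball z δ, ENNReal.ofReal (Real.exp (m * g θ)) *
              ((‖f w‖₊ : ℝ≥0∞) ^ p * expE (-((m : ℝ) : EReal) * φ w)) :=
                setLIntegral_mono' Metric.isOpen_ball.measurableSet hpt
            _ = ENNReal.ofReal (Real.exp (m * g θ)) * ∫⁻ w in Metric.ball z δ,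
              ((‖f w‖₊ : ℝ≥0∞) ^ p * expE (-((m : ℝ) : EReal) * φ w)) :=
                lintegral_const_mul' _ _ ENNReal.ofReal_ne_top
            _ ≤ ENNReal.ofReal (Real.exp (m * g θ)) * ∫⁻ w in D,
              ((‖f w‖₊ : ℝ≥0∞) ^ p * expE (-((m : ℝ) : EReal) * φ w)) := by
                gcongr
                exact fun w hw => (hball' w hw).1
            _ ≤ ENNReal.ofReal (Real.exp (m * g θ)) *
              (ENNReal.ofReal (C m) * ENNReal.ofReal (Real.exp (-m * x))) := by gcongr
            _ = _ := by
              rw [ENNReal.ofReal_mul (Real.exp_nonneg _), ENNReal.ofReal_mul (hCpos m).le]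
        have hfz : 0 < ‖f z‖ := norm_pos_iff.2 hne
        have hreal : ‖f z‖ ^ p * V.toReal ≤ Real.exp (m * g θ) * (C m * Real.exp (-m * x)) := by
          have h1 := ENNReal.toReal_mono ENNReal.ofReal_ne_top hchain
          rw [ENNReal.toReal_ofReal
            (mul_nonneg (Real.exp_nonneg _) (mul_nonneg (hCpos m).le (Real.exp_nonneg _))),
            ENNReal.toReal_mul, ← ENNReal.toReal_rpow] at h1
          simpa using h1
        have hlog := Real.log_le_log (mul_pos (Real.rpow_pos_of_pos hfz p) hVpos) hreal
        rw [Real.log_mul (Real.rpow_pos_of_pos hfz p).ne' hVpos.ne', Real.log_rpow hfz,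
          Real.log_mul (Real.exp_ne_zero _) (mul_pos (hCpos m) (Real.exp_pos _)).ne',
          Real.log_mul (hCpos m).ne' (Real.exp_ne_zero _), Real.log_exp, Real.log_exp] at hlog
        rw [le_div_iff₀ hp]
        change Real.log ‖f z‖ * p ≤ _
        linarith)
    have e : (fun θ => (m * (g θ - x) + Real.log (C m) - Real.log V.toReal) / p) =
        fun θ => (m / p) * (g θ + (- x + (Real.log (C m) / m - Real.log V.toReal / m))) := by
      funext θ
      field_simp
      ring
    rw [e, intervalIntegral.integral_const_mul, intervalIntegral.integral_add hgi (by simp),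
      intervalIntegral.integral_const] at key
    have := nonneg_of_mul_nonneg_right key (by positivity)
    simp only [sub_zero, smul_eq_mul] at this
    linarith
  have hlim : Filter.Tendsto (fun m : ℕ => (∫ θ in (0:ℝ)..(2 * Real.pi), g θ) +
      2 * Real.pi * (Real.log (C m) / m - Real.log V.toReal / m)) Filter.atTop
      (nhds ((∫ θ in (0:ℝ)..(2 * Real.pi), g θ) + 2 * Real.pi * (0 - 0))) :=
    ((hCgrowth.sub (tendsto_const_div_atTop_nhds_zero_nat _)).const_mul _).const_add _
  have := ge_of_tendsto hlim ((Filter.eventually_gt_atTop 0).mono main)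
  simpa using this

/-- Let `D ⊆ ℂⁿ` be a domain, `φ : D → [-∞, +∞)` upper semicontinuous and not
identically `-∞`, and `p > 0`. If there are constants `C m > 0` with `(log C m)/m → 0` such that
for every `z₀ ∈ D` with `φ z₀ > -∞` and every `m ≥ 1` there is a holomorphic `f` on `D` with
`f z₀ = 1` and `∫_D |f|^p e^{-mφ} ≤ C m · e^{-mφ(z₀)}`, then `φ` is plurisubharmonic on `D`. -/
theorem statement0 {n : ℕ} (D : Set (Fin n → ℂ)) (hDopen : IsOpen D) (hDconn : IsConnected D)
    (φ : (Fin n → ℂ) → EReal) (hφ_lt_top : ∀ z ∈ D, φ z < ⊤)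
    (hφ_usc : UpperSemicontinuousOn φ D)
    (hφ_ne_bot : ∃ z ∈ D, φ z ≠ ⊥)
    (p : ℝ) (hp : 0 < p)
    (C : ℕ → ℝ) (hCpos : ∀ m, 0 < C m)
    (hCgrowth : Filter.Tendsto (fun m : ℕ => Real.log (C m) / (m : ℝ)) Filter.atTop (nhds 0))
    (hext : ∀ z₀ ∈ D, φ z₀ ≠ ⊥ → ∀ m : ℕ, 0 < m →
      ∃ f : (Fin n → ℂ) → ℂ, DifferentiableOn ℂ f D ∧ f z₀ = 1 ∧
        (∫⁻ z in D, (‖f z‖₊ : ℝ≥0∞) ^ p * expE (-((m : ℝ) : EReal) * φ z)) ≤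
          ENNReal.ofReal (C m) * expE (-((m : ℝ) : EReal) * φ z₀)) :
    PlurisubharmonicOn φ D := by

  refine ⟨hφ_usc, fun a b => ⟨?_, ?_⟩⟩
  · intro w hw y hy
    have hcont : ContinuousWithinAt (fun w : ℂ => a + w • b) {w : ℂ | a + w • b ∈ D} w :=
      Continuous.continuousWithinAt (by fun_prop)
    have ht := hcont.tendsto_nhdsWithin (t := D) (fun _ h => h)
    exact ht.eventually (hφ_usc _ hw y hy)
  intro c r hr hball M hM
  have hcpt : ∀ θ, cpt c r θ = circleMap c r θ := fun θ => by simp [cpt, circleMap]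
  simp only [hcpt] at hM
  have hz0 : a + c • b ∈ D := hball (Metric.mem_closedBall_self hr.le)
  change φ (a + c • b) + _ ≤ _
  have htop := (hφ_lt_top _ hz0).ne
  by_cases hbot : φ (a + c • b) = ⊥
  · rw [hbot, EReal.bot_add]; exact bot_le
  lift φ (a + c • b) to ℝ using ⟨htop, hbot⟩ with x hx
  have hinD : ∀ θ, a + circleMap c r θ • b ∈ D := fun θ =>
    hball (circleMap_mem_closedBall c hr.le θ)
  have hmean := le_mean_majorant D hDopen φ hφ_usc p hp C hCpos hCgrowth hext a b c r hr hball
    x hx.symm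
  have h2pi : 0 < 2 * Real.pi := by positivity
  -- bound for minorants
  have hminor : ∀ g : ℝ → ℝ, Continuous g → (∀ θ, 0 ≤ g θ) →
      (∀ θ ∈ Set.Icc 0 (2 * Real.pi),
        ENNReal.ofReal (g θ) ≤ toENN ((M : EReal) - φ (a + circleMap c r θ • b))) →
      ∫ θ in (0:ℝ)..(2 * Real.pi), g θ ≤ 2 * Real.pi * (M - x) := by
    intro g hg hg0 hgle
    apply le_of_forall_pos_le_add
    intro ε hε
    have hε' : 0 < ε / (2 * Real.pi) := by positivity
    have := hmean (fun θ => M - g θ + ε / (2 * Real.pi)) (by fun_prop) (fun θ hθ =>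
      lt_of_le_toENN M (g θ) _ hε' _ (hM θ) (hgle θ hθ))
    rw [intervalIntegral.integral_add (Continuous.intervalIntegrable (by fun_prop) _ _) (by simp),
      intervalIntegral.integral_sub (by simp) (hg.intervalIntegrable _ _),
      intervalIntegral.integral_const, intervalIntegral.integral_const] at this
    simp only [sub_zero, smul_eq_mul] at this
    rw [mul_div_cancel₀ _ h2pi.ne'] at this
    linarith
  have hxM : 0 ≤ M - x := by
    have := hminor (fun _ => 0) continuous_const (fun _ => le_rfl) (by simp)
    simp only [intervalIntegral.integral_zero] at this
    exact nonneg_of_mul_nonneg_right this h2pi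
  have hfinal : ∫⁻ θ in Set.Ioc 0 (2 * Real.pi),
      toENN ((M : EReal) - φ (a + circleMap c r θ • b)) ≤
        ENNReal.ofReal (2 * Real.pi * (M - x)) := by
    apply lintegral_le_of_minorants h2pi
    · intro θ hθ s hs hlt
      have hne : ∀ t, φ (a + circleMap c r t • b) ≠ ⊤ := fun t => (hφ_lt_top _ (hinD t)).ne
      rw [lt_toENN_iff M s hs _ (hne θ)] at hlt
      have h1 := hφ_usc _ (hinD θ) _ hlt
      rw [hDopen.nhdsWithin_eq (hinD θ)] at h1
      have hcm : Continuous (circleMap c r) := continuous_circleMap c r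
      have hcont : ContinuousAt (fun t : ℝ => a + circleMap c r t • b) θ :=
        Continuous.continuousAt (by fun_prop)
      filter_upwards [nhdsWithin_le_nhds (hcont.eventually h1)] with t ht
      exact (lt_toENN_iff M s hs _ (hne t)).2 ht
    · intro g hg hg0 hgle
      rw [← ofReal_integral_eq_lintegral_ofReal hg.integrableOn_Ioc
        (Filter.Eventually.of_forall hg0), ← intervalIntegral.integral_of_le h2pi.le]
      exact ENNReal.ofReal_le_ofReal (hminor g hg hg0 hgle)
  have hdef : circleDeficit (fun w : ℂ => φ (a + w • b)) c r M ≤ ENNReal.ofReal (M - x) := by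
    unfold circleDeficit
    simp only [hcpt]
    apply ENNReal.div_le_of_le_mul
    rw [← ENNReal.ofReal_mul hxM, mul_comm (M - x)]
    exact hfinal
  calc (x : EReal) + ((circleDeficit (fun w : ℂ => φ (a + w • b)) c r M : ℝ≥0∞) : EReal)
      ≤ (x : EReal) + ((ENNReal.ofReal (M - x) : ℝ≥0∞) : EReal) := by
        gcongr
        exact_mod_cast hdef
    _ = (M : EReal) := by
        rw [EReal.coe_ennreal_ofReal, max_eq_left hxM, ← EReal.coe_add]
        congr 1; ring
end
end

section
/- Let D ⊆ ℂⁿ be a domain, φ : D → [-∞, +∞) upper semicontinuous, and p > 0. Then the function K_{φ,p} is continuous on D. -/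
open MeasureTheory Complex Set
open scoped ENNReal NNReal

noncomputable section

/-- The `L^p` integral `|f|_p = ∫_D |f|^p e^{-φ} dλ`. -/
def pIntNorm {n : ℕ} (D : Set (Fin n → ℂ)) (φ : (Fin n → ℂ) → EReal) (p : ℝ)
    (f : (Fin n → ℂ) → ℂ) : ℝ≥0∞ :=
  ∫⁻ z in D, (‖f z‖₊ : ℝ≥0∞) ^ p * expE (-(φ z))

/-- The kernel `K_{φ,p}(z) = sup { |f(z)|^p : f ∈ H^p(D,φ), |f|_p = 1 }` (equal to `0` by
convention if the supremum ranges over the empty set or if all such `f` vanish at `z`). -/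
def pBergmanKernel {n : ℕ} (D : Set (Fin n → ℂ)) (φ : (Fin n → ℂ) → EReal) (p : ℝ)
    (z : Fin n → ℂ) : ℝ≥0∞ :=
  ⨆ f ∈ {f : (Fin n → ℂ) → ℂ | DifferentiableOn ℂ f D ∧ pIntNorm D φ p f = 1},
    (‖f z‖₊ : ℝ≥0∞) ^ p

open Filter Topology Metric Real in
lemma one_var_real {g : ℂ → ℂ} (hg : AnalyticOnNhd ℂ g (closedBall 0 1)) {p : ℝ} (hp : 0 < p) :
    ‖g 0‖ ^ p ≤ circleAverage (fun z => ‖g z‖ ^ p) 0 1 := by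
  have hcont : ContinuousOn g (closedBall 0 1) := hg.continuousOn
  have hci : CircleIntegrable (fun z => ‖g z‖ ^ p) 0 1 := by
    apply ContinuousOn.circleIntegrable (by norm_num)
    exact ((hcont.mono sphere_subset_closedBall).norm).rpow_const (fun _ _ => Or.inr hp.le)
  by_cases h0 : g 0 = 0
  · rw [h0, norm_zero, Real.zero_rpow hp.ne']
    apply circleAverage_nonneg_of_nonneg
    intro x _
    positivity
  have ha : 0 < ‖g 0‖ := norm_pos_iff.2 h0
  have hR : (1 : ℝ) ≠ 0 := one_ne_zero
  have hg' : AnalyticOnNhd ℂ g (closedBall 0 |1|) := by simpa using hg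
  have hJ := hg'.circleAverage_log_norm hR h0
  have hsum : 0 ≤ ∑ᶠ u, (MeromorphicOn.divisor g (closedBall 0 |1|) u : ℝ)
      * Real.log (1 * ‖0 - u‖⁻¹) := by
    apply finsum_nonneg
    intro u
    by_cases hu : u ∈ closedBall (0 : ℂ) |1|
    · apply mul_nonneg
      · exact_mod_cast MeromorphicOn.AnalyticOnNhd.divisor_nonneg hg' u
      · simp only [abs_one, mem_closedBall, dist_zero_right] at hu
        rw [one_mul, zero_sub, norm_neg, Real.log_inv]
        have := Real.log_nonpos (norm_nonneg u) hu
        linarith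
    · rw [Function.locallyFinsuppWithin.apply_eq_zero_of_notMem _ hu]
      simp
  have hlog : Real.log ‖g 0‖ ≤ circleAverage (fun z => Real.log ‖g z‖) 0 1 := by
    rw [hJ]; linarith
  have hli : CircleIntegrable (fun z => Real.log ‖g z‖) 0 1 :=
    MeromorphicOn.circleIntegrable_log_norm
      (fun z hz => (hg' z (sphere_subset_closedBall hz)).meromorphicAt)
  have hne : g ⁻¹' {0}ᶜ ∈ codiscreteWithin (sphere (0 : ℂ) |1|) := by
    apply codiscreteWithin_mono sphere_subset_closedBall
    exact hg'.preimage_zero_mem_codiscreteWithin h0 (by simp)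
      ⟨⟨0, by simp⟩, (convex_closedBall _ _).isPreconnected⟩
  have hcongr : (fun z => ‖g z‖ ^ p) =ᶠ[codiscreteWithin (sphere (0 : ℂ) |1|)]
      (fun z => Real.exp (Real.log ‖g z‖ * p)) := by
    filter_upwards [hne] with z hz
    rw [Real.rpow_def_of_pos (norm_pos_iff.2 hz)]
  have hei := hci.congr_codiscreteWithin hcongr
  rw [circleAverage_congr_codiscreteWithin hcongr hR]
  set a := Real.log ‖g 0‖ with hadef
  have hap : ‖g 0‖ ^ p = Real.exp (a * p) := by
    rw [Real.rpow_def_of_pos ha]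
  have hc1 : CircleIntegrable (fun _ : ℂ => Real.exp (a * p) * (1 - a * p)) 0 1 :=
    continuousOn_const.circleIntegrable (by norm_num)
  have hc2 : CircleIntegrable (fun z : ℂ => (Real.exp (a * p) * p) • Real.log ‖g z‖) 0 1 :=
    hli.const_fun_smul
  calc ‖g 0‖ ^ p ≤ Real.exp (a * p) * (1 - a * p) +
        (Real.exp (a * p) * p) * circleAverage (fun z => Real.log ‖g z‖) 0 1 := by
        rw [hap]
        have : 0 ≤ (Real.exp (a * p) * p) *
          (circleAverage (fun z => Real.log ‖g z‖) 0 1 - a) :=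
          mul_nonneg (by positivity) (by linarith)
        nlinarith
    _ = circleAverage (fun z => Real.exp (a * p) * (1 - a * p) +
          (Real.exp (a * p) * p) • Real.log ‖g z‖) 0 1 := by
        rw [circleAverage_fun_add hc1 hc2, circleAverage_const, circleAverage_fun_smul, smul_eq_mul]
    _ ≤ _ := by
        apply circleAverage_mono (hc1.add hc2) hei
        intro z _
        have h1 := Real.add_one_le_exp (Real.log ‖g z‖ * p - a * p)
        have h2 : Real.exp (Real.log ‖g z‖ * p) =
          Real.exp (a * p) * Real.exp (Real.log ‖g z‖ * p - a * p) := by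
          rw [← Real.exp_add]; ring_nf
        have h3 := Real.exp_pos (a * p)
        simp only [smul_eq_mul, Pi.add_apply]
        rw [h2]
        nlinarith

open Filter Topology Metric in
lemma one_var {g : ℂ → ℂ} (hg : AnalyticOnNhd ℂ g (closedBall 0 1)) {p : ℝ} (hp : 0 < p) :
    ENNReal.ofReal (2 * Real.pi) * (‖g 0‖₊ : ℝ≥0∞) ^ p ≤
      ∫⁻ θ in Set.Ioc 0 (2 * Real.pi), (‖g (circleMap 0 1 θ)‖₊ : ℝ≥0∞) ^ p := by
  have h := one_var_real hg hp
  have hci : CircleIntegrable (fun z => ‖g z‖ ^ p) 0 1 := by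
    apply ContinuousOn.circleIntegrable (by norm_num)
    exact ((hg.continuousOn.mono sphere_subset_closedBall).norm).rpow_const (fun _ _ => Or.inr hp.le)
  have key : ∀ x : ℂ, (‖x‖₊ : ℝ≥0∞) ^ p = ENNReal.ofReal (‖x‖ ^ p) := by
    intro x
    rw [← ENNReal.ofReal_rpow_of_nonneg (norm_nonneg _) hp.le, ofReal_norm]
    rfl
  simp only [key]
  have hpi : (0 : ℝ) ≤ 2 * Real.pi := by positivity
  rw [← ofReal_integral_eq_lintegral_ofReal, ← ENNReal.ofReal_mul hpi]
  · apply ENNReal.ofReal_le_ofReal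
    rw [Real.circleAverage_def, smul_eq_mul, intervalIntegral.integral_of_le hpi] at h
    have h2 := mul_le_mul_of_nonneg_left h hpi
    rwa [mul_inv_cancel_left₀ (by positivity)] at h2
  · have := hci
    unfold CircleIntegrable at this
    exact (intervalIntegrable_iff_integrableOn_Ioc_of_le hpi).1 this
  · exact Filter.Eventually.of_forall fun θ => by positivity

lemma rot_mp {n : ℕ} (c : ℂ) (hc : ‖c‖ = 1) :
    MeasurePreserving (fun v : Fin n → ℂ => c • v) volume volume := by
  have h1 : MeasurePreserving (fun z : ℂ => c * z) volume volume := by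
    have := (rotation ⟨c, by simp [Submonoid.unitSphere, hc]⟩).measurePreserving
    exact this
  exact volume_preserving_pi (fun _ : Fin n => h1)

open Filter Topology Metric Classical in
lemma submean {n : ℕ} {f : (Fin n → ℂ) → ℂ} {w : Fin n → ℂ} {r : ℝ}
    (hf : DifferentiableOn ℂ f (ball w r)) {p : ℝ} (hp : 0 < p) :
    volume (ball (0 : Fin n → ℂ) r) * (‖f w‖₊ : ℝ≥0∞) ^ p ≤
      ∫⁻ z in ball w r, (‖f z‖₊ : ℝ≥0∞) ^ p := by
  set F : (Fin n → ℂ) → ℝ≥0∞ :=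
    (ball (0 : Fin n → ℂ) r).indicator (fun v => (‖f (w + v)‖₊ : ℝ≥0∞) ^ p) with hF
  have hmaps : MapsTo (fun v : Fin n → ℂ => w + v) (ball 0 r) (ball w r) := by
    intro v hv
    simpa [mem_ball_iff_norm] using hv
  have hFm : Measurable F := by
    have hc : ContinuousOn (fun v => (‖f (w + v)‖₊ : ℝ≥0∞) ^ p) (ball (0 : Fin n → ℂ) r) := by
      have h1 : ContinuousOn (fun v => f (w + v)) (ball (0 : Fin n → ℂ) r) :=
        hf.continuousOn.comp (by fun_prop) hmaps
      exact ENNReal.continuous_rpow_const.comp_continuousOn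
        (ENNReal.continuous_coe.comp_continuousOn h1.nnnorm)
    rw [hF, ← Set.piecewise_eq_indicator]
    exact hc.measurable_piecewise continuousOn_const measurableSet_ball
  have hpt : ∀ v, (ball (0 : Fin n → ℂ) r).indicator
      (fun _ => ENNReal.ofReal (2 * Real.pi) * (‖f w‖₊ : ℝ≥0∞) ^ p) v ≤
      ∫⁻ θ in Set.Ioc 0 (2 * Real.pi), F (circleMap 0 1 θ • v) := by
    intro v
    by_cases hv : v ∈ ball (0 : Fin n → ℂ) r
    · rw [indicator_of_mem hv]
      have hg : AnalyticOnNhd ℂ (fun t : ℂ => f (w + t • v)) (closedBall 0 1) := by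
        have ho : IsOpen ((fun t : ℂ => w + t • v) ⁻¹' ball w r) :=
          isOpen_ball.preimage (by fun_prop)
        have hd : DifferentiableOn ℂ (fun t : ℂ => f (w + t • v))
            ((fun t : ℂ => w + t • v) ⁻¹' ball w r) :=
          hf.comp (by fun_prop) (fun _ h => h)
        refine (hd.analyticOnNhd ho).mono ?_
        intro t ht
        simp only [mem_preimage, mem_ball_iff_norm, add_sub_cancel_left, norm_smul]
        simp only [mem_closedBall, dist_zero_right] at ht hv
        rw [mem_ball_zero_iff] at hv
        exact lt_of_le_of_lt (mul_le_of_le_one_left (norm_nonneg _) ht) hv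
      have := one_var hg hp
      simp only [zero_smul, add_zero] at this
      refine this.trans (le_of_eq ?_)
      apply lintegral_congr
      intro θ
      rw [hF, indicator_of_mem]
      rw [mem_ball_zero_iff] at hv ⊢
      simpa [norm_smul] using hv
    · rw [indicator_of_notMem hv]
      exact zero_le
  have hint := lintegral_mono (μ := volume) hpt
  rw [lintegral_indicator measurableSet_ball, setLIntegral_const,
    lintegral_lintegral_swap] at hint
  · have hrot : ∀ θ : ℝ, ∫⁻ v, F (circleMap 0 1 θ • v) = ∫⁻ v, F v := fun θ =>
      (rot_mp (circleMap 0 1 θ) (by simp)).lintegral_comp hFm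
    simp only [hrot] at hint
    rw [setLIntegral_const, Real.volume_Ioc, sub_zero] at hint
    have h2 : ∫⁻ v, F v = ∫⁻ z in ball w r, (‖f z‖₊ : ℝ≥0∞) ^ p := by
      rw [← lintegral_indicator measurableSet_ball,
        ← lintegral_add_left_eq_self ((ball w r).indicator _) w]
      apply lintegral_congr
      intro v
      simp only [hF, indicator, mem_ball_iff_norm, add_sub_cancel_left, sub_zero]
    rw [h2, mul_comm _ (ENNReal.ofReal (2 * Real.pi)), mul_assoc] at hint
    have hpos : ENNReal.ofReal (2 * Real.pi) ≠ 0 := by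
      simp [Real.pi_pos]
    rw [ENNReal.mul_le_mul_iff_right hpos ENNReal.ofReal_ne_top] at hint
    rwa [mul_comm]
  · apply Measurable.aemeasurable
    apply hFm.comp
    have : Continuous fun q : (Fin n → ℂ) × ℝ => circleMap 0 1 q.2 • q.1 := by fun_prop
    exact this.measurable

open Filter Topology Metric in
lemma local_bound {n : ℕ} (D : Set (Fin n → ℂ)) (hDopen : IsOpen D)
    (φ : (Fin n → ℂ) → EReal) (hφ_lt_top : ∀ z ∈ D, φ z < ⊤)
    (hφ_usc : UpperSemicontinuousOn φ D)
    (p : ℝ) (hp : 0 < p) (z₀ : Fin n → ℂ) (hz₀ : z₀ ∈ D) :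
    ∃ r > 0, ball z₀ r ⊆ D ∧ ∃ M : ℝ, 0 ≤ M ∧ ∀ f, DifferentiableOn ℂ f D → pIntNorm D φ p f = 1 →
      ∀ w ∈ ball z₀ r, ‖f w‖ ≤ M := by
  obtain ⟨A, hA1, hA2⟩ := EReal.lt_iff_exists_real_btwn.1 (hφ_lt_top z₀ hz₀)
  have h1 := hφ_usc z₀ hz₀ _ hA1
  rw [hDopen.nhdsWithin_eq hz₀] at h1
  obtain ⟨R, hR, hRs⟩ := Metric.mem_nhds_iff.1 (h1.and (hDopen.mem_nhds hz₀))
  set c : ℝ≥0∞ := expE (-(A : EReal)) with hc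
  have hcval : c = ENNReal.ofReal (Real.exp (-A)) := by
    rw [hc, expE, ← EReal.coe_neg, EReal.exp_coe]
  have hc0 : c ≠ 0 := by rw [hcval]; simp [Real.exp_pos]
  have hct : c ≠ ⊤ := by rw [hcval]; simp
  have hV0 : volume (ball (0 : Fin n → ℂ) (R / 2)) ≠ 0 :=
    (measure_ball_pos _ _ (by positivity)).ne'
  have hVt : volume (ball (0 : Fin n → ℂ) (R / 2)) ≠ ⊤ := measure_ball_lt_top.ne
  set V := volume (ball (0 : Fin n → ℂ) (R / 2))
  have hB : (V * c)⁻¹ ≠ ⊤ := ENNReal.inv_ne_top.2 (mul_ne_zero hV0 hc0)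
  refine ⟨R / 2, by positivity, fun z hz => (hRs (ball_subset_ball (by linarith) hz)).2,
    (((V * c)⁻¹) ^ (1 / p)).toReal, ENNReal.toReal_nonneg, ?_⟩
  intro f hf hn w hw
  have hsub : ball w (R / 2) ⊆ ball z₀ R := by
    apply ball_subset_ball'
    rw [mem_ball] at hw
    linarith
  have h2 := submean (hf.mono (fun z hz => (hRs (hsub hz)).2)) hp (w := w) (r := R / 2)
  have h3 : (∫⁻ z in ball w (R / 2), (‖f z‖₊ : ℝ≥0∞) ^ p) * c ≤ 1 := by
    rw [← lintegral_mul_const' _ _ hct, ← hn, pIntNorm]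
    calc _ ≤ ∫⁻ z in ball w (R / 2), (‖f z‖₊ : ℝ≥0∞) ^ p * expE (-(φ z)) := by
          apply setLIntegral_mono' measurableSet_ball
          intro z hz
          gcongr
          exact EReal.exp_monotone (EReal.neg_le_neg_iff.2 (hRs (hsub hz)).1.le)
      _ ≤ _ := lintegral_mono_set (fun z hz => (hRs (hsub hz)).2)
  have h4 : (‖f w‖₊ : ℝ≥0∞) ^ p ≤ (V * c)⁻¹ := by
    rw [ENNReal.le_inv_iff_mul_le]
    calc (‖f w‖₊ : ℝ≥0∞) ^ p * (V * c) = V * (‖f w‖₊ : ℝ≥0∞) ^ p * c := by ring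
      _ ≤ _ := mul_le_mul_left h2 c
      _ ≤ 1 := h3
  have h5 : (‖f w‖₊ : ℝ≥0∞) ≤ ((V * c)⁻¹) ^ (1 / p) := by
    rw [one_div]
    exact (ENNReal.le_rpow_inv_iff hp).2 h4
  have h6 := ENNReal.toReal_mono (ENNReal.rpow_ne_top_of_nonneg (by positivity) hB) h5
  simpa using h6

open Filter Topology Metric in
/-- Let `D ⊆ ℂⁿ` be a domain, `φ : D → [-∞, +∞)` upper semicontinuous, and
`p > 0`. Then the function `K_{φ,p}` is continuous on `D`. -/
theorem statement1 {n : ℕ} (D : Set (Fin n → ℂ)) (hDopen : IsOpen D) (hDconn : IsConnected D)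
    (φ : (Fin n → ℂ) → EReal) (hφ_lt_top : ∀ z ∈ D, φ z < ⊤)
    (hφ_usc : UpperSemicontinuousOn φ D)
    (p : ℝ) (hp : 0 < p) :
    ContinuousOn (pBergmanKernel D φ p) D := by
  intro z₀ hz₀
  apply ContinuousAt.continuousWithinAt
  obtain ⟨r, hr, hrD, M, hM, hb⟩ := local_bound D hDopen φ hφ_lt_top hφ_usc p hp z₀ hz₀
  have key : ∀ x : ℂ, (‖x‖₊ : ℝ≥0∞) ^ p = ENNReal.ofReal (‖x‖ ^ p) := by
    intro x
    rw [← ENNReal.ofReal_rpow_of_nonneg (norm_nonneg _) hp.le, ofReal_norm]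
    rfl
  have hfin : pBergmanKernel D φ p z₀ ≠ ⊤ := by
    refine ne_top_of_le_ne_top (ENNReal.ofReal_ne_top (r := M ^ p)) ?_
    apply iSup₂_le
    intro f hf
    rw [key]
    apply ENNReal.ofReal_le_ofReal
    exact Real.rpow_le_rpow (norm_nonneg _) (hb f hf.1 hf.2 z₀ (mem_ball_self hr)) hp.le
  rw [ContinuousAt, ENNReal.tendsto_nhds hfin]
  intro ε hε
  obtain ⟨e, he0, heε⟩ : ∃ e : ℝ, 0 < e ∧ ENNReal.ofReal e ≤ ε := by
    rcases eq_or_ne ε ⊤ with h | h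
    · exact ⟨1, one_pos, by simp [h]⟩
    · exact ⟨ε.toReal, ENNReal.toReal_pos hε.ne' h, ENNReal.ofReal_toReal_le⟩
  have huc : UniformContinuousOn (fun t : ℝ => t ^ p) (Icc 0 M) :=
    isCompact_Icc.uniformContinuousOn_of_continuous
      (continuousOn_id.rpow_const (fun _ _ => Or.inr hp.le))
  obtain ⟨δ, hδ, hδe⟩ := Metric.uniformContinuousOn_iff.1 huc e he0
  have hlim : ∀ᶠ z in 𝓝 z₀, 2 * M / r * dist z z₀ < δ := by
    have : Tendsto (fun z => 2 * M / r * dist z z₀) (𝓝 z₀) (𝓝 (2 * M / r * dist z₀ z₀)) :=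
      Continuous.tendsto (by fun_prop) z₀
    rw [dist_self, mul_zero] at this
    exact this.eventually (gt_mem_nhds hδ)
  filter_upwards [hlim, ball_mem_nhds z₀ hr] with z hz1 hz2
  have hfz : ∀ f, DifferentiableOn ℂ f D → pIntNorm D φ p f = 1 →
      |‖f z‖ ^ p - ‖f z₀‖ ^ p| < e := by
    intro f hf hn
    have hd : dist (f z) (f z₀) ≤ 2 * M / r * dist z z₀ := by
      apply Complex.dist_le_div_mul_dist_of_mapsTo_ball (hf.mono hrD) _ hz2
      intro w hw
      rw [mem_closedBall, dist_eq_norm]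
      have h1 := hb f hf hn w hw
      have h2 := hb f hf hn z₀ (mem_ball_self hr)
      linarith [norm_sub_le (f w) (f z₀)]
    apply hδe ‖f z‖ ⟨norm_nonneg _, hb f hf hn z hz2⟩ ‖f z₀‖
      ⟨norm_nonneg _, hb f hf hn z₀ (mem_ball_self hr)⟩
    rw [Real.dist_eq]
    rw [dist_eq_norm] at hd
    exact lt_of_le_of_lt ((abs_norm_sub_norm_le _ _).trans hd) hz1
  constructor
  · rw [tsub_le_iff_right]
    apply iSup₂_le
    intro f hf
    have h1 := abs_lt.1 (hfz f hf.1 hf.2)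
    have h2 : (‖f z‖₊ : ℝ≥0∞) ^ p ≤ pBergmanKernel D φ p z :=
      le_iSup₂ (f := fun (f : (Fin n → ℂ) → ℂ) (_ : f ∈ {f : (Fin n → ℂ) → ℂ |
        DifferentiableOn ℂ f D ∧ pIntNorm D φ p f = 1}) => (‖f z‖₊ : ℝ≥0∞) ^ p) f hf
    refine le_trans ?_ (add_le_add h2 heε)
    rw [key, key, ← ENNReal.ofReal_add (by positivity) he0.le]
    exact ENNReal.ofReal_le_ofReal (by linarith)
  · apply iSup₂_le
    intro f hf
    have h1 := abs_lt.1 (hfz f hf.1 hf.2)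
    have h2 : (‖f z₀‖₊ : ℝ≥0∞) ^ p ≤ pBergmanKernel D φ p z₀ :=
      le_iSup₂ (f := fun (f : (Fin n → ℂ) → ℂ) (_ : f ∈ {f : (Fin n → ℂ) → ℂ |
        DifferentiableOn ℂ f D ∧ pIntNorm D φ p f = 1}) => (‖f z₀‖₊ : ℝ≥0∞) ^ p) f hf
    refine le_trans ?_ (add_le_add h2 heε)
    rw [key, key, ← ENNReal.ofReal_add (by positivity) he0.le]
    exact ENNReal.ofReal_le_ofReal (by linarith)
end
end

section
/- Let D ⊆ ℂⁿ be a domain, φ : D → [-∞, +∞) upper semicontinuous, and p > 0. Then log K_{φ,p} is a plurisubharmonic function on D. -/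
open MeasureTheory Complex Set
open scoped ENNReal NNReal

noncomputable section

lemma aux_jensen {g : ℂ → ℂ} {c : ℂ} {r : ℝ} (hr : 0 < r)
    (hg : AnalyticOnNhd ℂ g (Metric.closedBall c r)) (hgc : g c ≠ 0) :
    Real.log ‖g c‖ ≤ Real.circleAverage (fun z => Real.log ‖g z‖) c r := by
  have hg' : AnalyticOnNhd ℂ g (Metric.closedBall c |r|) := by rwa [abs_of_pos hr]
  rw [AnalyticOnNhd.circleAverage_log_norm hr.ne' hg' hgc]
  have : 0 ≤ ∑ᶠ u, (MeromorphicOn.divisor g (Metric.closedBall c |r|) u : ℝ)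
      * Real.log (r * ‖c - u‖⁻¹) := by
    apply finsum_nonneg
    intro u
    by_cases hu : u ∈ Metric.closedBall c |r|
    · refine mul_nonneg (mod_cast MeromorphicOn.AnalyticOnNhd.divisor_nonneg hg' u) ?_
      rcases eq_or_ne c u with h | h
      · simp [h]
      · apply Real.log_nonneg
        rw [abs_of_pos hr, Metric.mem_closedBall, dist_comm, dist_eq_norm] at hu
        have : 0 < ‖c - u‖ := norm_pos_iff.2 (sub_ne_zero.2 h)
        rw [← div_eq_mul_inv, le_div_iff₀ this]
        linarith
    · rw [Function.locallyFinsuppWithin.apply_eq_zero_of_notMem _ hu]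
      simp
  linarith

lemma aux_ae {g : ℂ → ℂ} {c : ℂ} {r : ℝ} (hr : 0 < r)
    (hg : AnalyticOnNhd ℂ g (Metric.closedBall c r)) (hgc : g c ≠ 0) :
    ∀ᵐ θ ∂(volume.restrict (Set.Ioc 0 (2 * Real.pi))), g (circleMap c r θ) ≠ 0 := by
  have hc : c ∈ Metric.closedBall c r := Metric.mem_closedBall_self hr.le
  have h := hg.preimage_zero_mem_codiscreteWithin (x := c) hgc hc
    ((convex_closedBall c r).isConnected ⟨c, hc⟩)
  have h2 : g ⁻¹' {0}ᶜ ∈ Filter.codiscreteWithin (Metric.sphere c |r|) :=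
    Filter.codiscreteWithin_mono
      (by rw [abs_of_pos hr]; exact Metric.sphere_subset_closedBall) h
  apply ae_restrict_le_codiscreteWithin measurableSet_Ioc
  exact Filter.codiscreteWithin_mono (Set.subset_univ _) (circleMap_preimage_codiscrete hr.ne' h2)

lemma aux_integrable {g : ℂ → ℂ} {c : ℂ} {r : ℝ} (hr : 0 < r)
    (hg : AnalyticOnNhd ℂ g (Metric.closedBall c r)) :
    Integrable (fun θ => Real.log ‖g (circleMap c r θ)‖)
      (volume.restrict (Set.Ioc 0 (2 * Real.pi))) := by
  have hg' : AnalyticOnNhd ℂ g (Metric.sphere c |r|) := by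
    rw [abs_of_pos hr]; exact hg.mono Metric.sphere_subset_closedBall
  have := hg'.meromorphicOn.circleIntegrable_log_norm
  exact (intervalIntegrable_iff_integrableOn_Ioc_of_le Real.two_pi_pos.le).1 this

lemma aux_avg {g : ℂ → ℂ} {c : ℂ} {r : ℝ} (hr : 0 < r)
    (hg : AnalyticOnNhd ℂ g (Metric.closedBall c r)) (hgc : g c ≠ 0) :
    2 * Real.pi * Real.log ‖g c‖ ≤
      ∫ θ in Set.Ioc 0 (2 * Real.pi), Real.log ‖g (circleMap c r θ)‖ := by
  have h := aux_jensen hr hg hgc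
  rw [Real.circleAverage, smul_eq_mul,
    intervalIntegral.integral_of_le Real.two_pi_pos.le] at h
  have h2 := mul_le_mul_of_nonneg_left h Real.two_pi_pos.le
  rwa [mul_inv_cancel_left₀ Real.two_pi_pos.ne'] at h2

lemma aux_log {x : ℂ} (hx : x ≠ 0) {p : ℝ} :
    logE ((‖x‖₊ : ℝ≥0∞) ^ p) = ((p * Real.log ‖x‖ : ℝ) : EReal) := by
  have h : (‖x‖₊ : ℝ≥0∞) = ENNReal.ofReal ‖x‖ := by
    rw [← enorm_eq_nnnorm, ofReal_norm]
  rw [logE, ENNReal.log_rpow, h, ENNReal.log_ofReal_of_pos (norm_pos_iff.2 hx)]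
  norm_cast

lemma aux_submean {g : ℂ → ℂ} {c : ℂ} {r : ℝ} (hr : 0 < r) {p : ℝ} (hp : 0 < p)
    (hg : AnalyticOnNhd ℂ g (Metric.closedBall c r)) :
    SubmeanAt (fun w => logE ((‖g w‖₊ : ℝ≥0∞) ^ p)) c r := by
  intro M hM
  by_cases hgc : g c = 0
  · have : logE ((‖g c‖₊ : ℝ≥0∞) ^ p) = ⊥ := by simp [hgc, hp, logE]
    simp only [this, EReal.bot_add, bot_le]
  have hcpt : ∀ θ, cpt c r θ = circleMap c r θ := fun θ => rfl
  have hae := aux_ae hr hg hgc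
  have hint := aux_integrable hr hg
  have havg := aux_avg hr hg hgc
  have hD : circleDeficit (fun w => logE ((‖g w‖₊ : ℝ≥0∞) ^ p)) c r M
      = ENNReal.ofReal ((∫ θ in Set.Ioc 0 (2 * Real.pi),
          (M - p * Real.log ‖g (circleMap c r θ)‖)) / (2 * Real.pi)) := by
    rw [circleDeficit, ENNReal.ofReal_div_of_pos Real.two_pi_pos,
      ofReal_integral_eq_lintegral_ofReal]
    · congr 1
      apply lintegral_congr_ae
      filter_upwards [hae] with θ hθ
      rw [hcpt, aux_log hθ, ← EReal.coe_sub, toENN, if_neg (EReal.coe_ne_top _), EReal.toReal_coe]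
    · exact (integrable_const M).sub (hint.const_mul p)
    · filter_upwards [hae] with θ hθ
      have := hM θ
      simp only [hcpt, aux_log hθ, EReal.coe_le_coe_iff] at this
      simpa using this
  have hnn : 0 ≤ (∫ θ in Set.Ioc 0 (2 * Real.pi),
          (M - p * Real.log ‖g (circleMap c r θ)‖)) := by
    apply integral_nonneg_of_ae
    filter_upwards [hae] with θ hθ
    have := hM θ
    simp only [hcpt, aux_log hθ, EReal.coe_le_coe_iff] at this
    simpa using this
  rw [hD, EReal.coe_ennreal_ofReal, max_eq_left (div_nonneg hnn Real.two_pi_pos.le)]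
  simp only [aux_log hgc]
  rw [← EReal.coe_add, EReal.coe_le_coe_iff, integral_sub (integrable_const M) (hint.const_mul p),
    integral_const_mul]
  simp only [integral_const, MeasurableSet.univ, measureReal_restrict_apply, univ_inter,
    Real.volume_real_Ioc, sub_zero, smul_eq_mul, max_eq_left Real.two_pi_pos.le]
  rw [sub_div, mul_div_cancel_left₀ _ Real.two_pi_pos.ne']
  have : p * Real.log ‖g c‖ ≤ p * (∫ θ in Set.Ioc 0 (2 * Real.pi),
      Real.log ‖g (circleMap c r θ)‖) / (2 * Real.pi) := by
    rw [le_div_iff₀ Real.two_pi_pos]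
    have := mul_le_mul_of_nonneg_left havg hp.le
    linarith
  linarith

lemma aux_rpow_submean {g : ℂ → ℂ} {c : ℂ} {r : ℝ} (hr : 0 < r) {p : ℝ} (hp : 0 < p)
    (hg : AnalyticOnNhd ℂ g (Metric.closedBall c r)) :
    (‖g c‖₊ : ℝ≥0∞) ^ p * ENNReal.ofReal (2 * Real.pi) ≤
      ∫⁻ θ in Set.Ioc 0 (2 * Real.pi), (‖g (circleMap c r θ)‖₊ : ℝ≥0∞) ^ p := by
  by_cases hgc : g c = 0
  · simp [hgc, hp]
  have hae := aux_ae hr hg hgc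
  have hint := aux_integrable hr hg
  have havg := aux_avg hr hg hgc
  have hconv : ∀ x : ℂ, (‖x‖₊ : ℝ≥0∞) ^ p = ENNReal.ofReal (‖x‖ ^ p) := by
    intro x
    rw [← ENNReal.ofReal_rpow_of_nonneg (norm_nonneg _) hp.le, ofReal_norm, enorm_eq_nnnorm]
  simp_rw [hconv]
  rw [← ENNReal.ofReal_mul (by positivity)]
  set A := ‖g c‖ ^ p with hA
  have hApos : 0 < A := Real.rpow_pos_of_pos (norm_pos_iff.2 hgc) _
  have hi2 : Integrable (fun θ => A * (1 - p * Real.log ‖g c‖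
      + p * Real.log ‖g (circleMap c r θ)‖)) (volume.restrict (Set.Ioc 0 (2 * Real.pi))) :=
    ((integrable_const _).add (hint.const_mul p)).const_mul A
  calc ENNReal.ofReal (A * (2 * Real.pi)) 
      ≤ ENNReal.ofReal (∫ θ in Set.Ioc 0 (2 * Real.pi), A * (1 - p * Real.log ‖g c‖
          + p * Real.log ‖g (circleMap c r θ)‖)) := by
        apply ENNReal.ofReal_le_ofReal
        rw [integral_const_mul, integral_add (integrable_const _) (hint.const_mul p),
          integral_const_mul]
        simp only [integral_const, MeasurableSet.univ, measureReal_restrict_apply, univ_inter,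
          Real.volume_real_Ioc, sub_zero, smul_eq_mul, max_eq_left Real.two_pi_pos.le]
        apply mul_le_mul_of_nonneg_left _ hApos.le
        have := mul_le_mul_of_nonneg_left havg hp.le
        linarith
    _ ≤ ∫⁻ θ in Set.Ioc 0 (2 * Real.pi), ENNReal.ofReal (A * (1 - p * Real.log ‖g c‖
          + p * Real.log ‖g (circleMap c r θ)‖)) := by
        rw [integral_eq_lintegral_pos_part_sub_lintegral_neg_part hi2]
        refine (ENNReal.ofReal_le_ofReal (sub_le_self _ ENNReal.toReal_nonneg)).trans ?_
        exact ENNReal.ofReal_toReal_le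
    _ ≤ _ := by
        apply lintegral_mono_ae
        filter_upwards [hae] with θ hθ
        apply ENNReal.ofReal_le_ofReal
        have h1 : 0 < ‖g (circleMap c r θ)‖ := norm_pos_iff.2 hθ
        have h2 : 0 < ‖g c‖ := norm_pos_iff.2 hgc
        have h3 := Real.add_one_le_exp
          (p * Real.log ‖g (circleMap c r θ)‖ - p * Real.log ‖g c‖)
        have h4 : A = Real.exp (p * Real.log ‖g c‖) := by
          rw [hA, Real.rpow_def_of_pos h2, mul_comm]
        have h5 : ‖g (circleMap c r θ)‖ ^ p
            = A * Real.exp (p * Real.log ‖g (circleMap c r θ)‖ - p * Real.log ‖g c‖) := by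
          rw [h4, ← Real.exp_add, Real.rpow_def_of_pos h1]
          congr 1; ring
        rw [h5]
        apply mul_le_mul_of_nonneg_left _ hApos.le
        linarith

lemma aux_rot {n : ℕ} (θ : ℝ) :
    MeasurePreserving (fun z : Fin n → ℂ => Complex.exp (θ * Complex.I) • z) := by
  have h := volume_preserving_pi (ι := Fin n) (α' := fun _ => ℂ) (β' := fun _ => ℂ)
    (f := fun _ => (rotation (Circle.exp θ) : ℂ → ℂ))
    (fun _ => (rotation (Circle.exp θ)).measurePreserving)
  have e : (fun z : Fin n → ℂ => Complex.exp (θ * Complex.I) • z) =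
      fun a i => (rotation (Circle.exp θ)) (a i) := by
    ext z i
    simp [rotation_apply]
  rw [e]
  exact h

lemma aux_ball {n : ℕ} {f : (Fin n → ℂ) → ℂ} {z₀ : Fin n → ℂ} {r : ℝ}
    {p : ℝ} (hp : 0 < p) (hf : DifferentiableOn ℂ f (Metric.ball z₀ r)) :
    (‖f z₀‖₊ : ℝ≥0∞) ^ p * volume (Metric.ball (0 : Fin n → ℂ) r) ≤
      ∫⁻ z in Metric.ball z₀ r, (‖f z‖₊ : ℝ≥0∞) ^ p := by
  set B := Metric.ball (0 : Fin n → ℂ) r with hB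
  -- the function extended by zero
  set F : (Fin n → ℂ) → ℝ≥0∞ := B.indicator (fun z => (‖f (z₀ + z)‖₊ : ℝ≥0∞) ^ p) with hF
  have hmaps : ∀ z ∈ B, z₀ + z ∈ Metric.ball z₀ r := by
    intro z hz; simpa [hB] using hz
  have hFm : Measurable F := by
    have hc : ContinuousOn (fun z => (‖f (z₀ + z)‖₊ : ℝ≥0∞) ^ p) B := by
      have h1 : ContinuousOn (fun z => f (z₀ + z)) B :=
        hf.continuousOn.comp (by fun_prop) hmaps
      exact ENNReal.continuous_rpow_const.comp_continuousOn
        (ENNReal.continuous_coe.comp_continuousOn h1.nnnorm)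
    classical
    rw [hF, ← Set.piecewise_eq_indicator]
    exact hc.measurable_piecewise continuous_zero.continuousOn Metric.isOpen_ball.measurableSet
  have e1 : ∫⁻ z in Metric.ball z₀ r, (‖f z‖₊ : ℝ≥0∞) ^ p = ∫⁻ z, F z := by
    rw [← lintegral_indicator Metric.isOpen_ball.measurableSet,
      ← lintegral_add_left_eq_self _ z₀]
    congr 1; ext z
    simp [hF, hB, Set.indicator]
  have e2 : ∀ θ : ℝ, ∫⁻ z, F z = ∫⁻ z, F (Complex.exp (θ * Complex.I) • z) := fun θ =>
    ((aux_rot θ).lintegral_comp hFm).symm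
  have hmF2 : Measurable (fun q : ℝ × (Fin n → ℂ) => F (Complex.exp (q.1 * Complex.I) • q.2)) := by
    apply hFm.comp
    apply Continuous.measurable
    fun_prop
  have e3 : (∫⁻ z, F z) * ENNReal.ofReal (2 * Real.pi) =
      ∫⁻ z, ∫⁻ θ in Set.Ioc 0 (2 * Real.pi), F (Complex.exp ((θ : ℝ) * Complex.I) • z) := by
    rw [← lintegral_lintegral_swap]
    · simp_rw [← e2]
      simp
    · exact hmF2.aemeasurable
  have key : ∀ z ∈ B, (‖f z₀‖₊ : ℝ≥0∞) ^ p * ENNReal.ofReal (2 * Real.pi) ≤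
      ∫⁻ θ in Set.Ioc 0 (2 * Real.pi), F (Complex.exp ((θ : ℝ) * Complex.I) • z) := by
    intro z hz
    have hU : IsOpen {w : ℂ | w • z ∈ B} :=
      Metric.isOpen_ball.preimage (by fun_prop : Continuous fun w : ℂ => w • z)
    have hsub : Metric.closedBall (0 : ℂ) 1 ⊆ {w : ℂ | w • z ∈ B} := by
      intro w hw
      simp only [hB, mem_ofPred_eq, mem_ball_zero_iff, norm_smul] at *
      simp only [mem_closedBall_zero_iff] at hw
      nlinarith [norm_nonneg z, norm_nonneg w]
    have hd : DifferentiableOn ℂ (fun w : ℂ => f (z₀ + w • z)) {w : ℂ | w • z ∈ B} := by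
      apply hf.comp (by fun_prop)
      intro w hw
      exact hmaps _ hw
    have := aux_rpow_submean (c := 0) one_pos hp ((hd.analyticOnNhd hU).mono hsub)
    simp only [zero_smul, add_zero] at this
    refine this.trans (le_of_eq ?_)
    congr 1; ext θ
    have h1 : circleMap 0 1 θ = Complex.exp (θ * Complex.I) := by simp [circleMap]
    have h2 : Complex.exp (θ * Complex.I) • z ∈ B := hsub (by
      simp [Complex.norm_exp_ofReal_mul_I])
    rw [h1, hF, Set.indicator_of_mem h2]
  have h2pi : ENNReal.ofReal (2 * Real.pi) ≠ 0 := by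
    simp [Real.pi_pos]
  rw [e1, ← ENNReal.mul_le_mul_iff_left h2pi ENNReal.ofReal_ne_top, e3]
  calc _ = ∫⁻ z in B, (‖f z₀‖₊ : ℝ≥0∞) ^ p * ENNReal.ofReal (2 * Real.pi) := by
        rw [setLIntegral_const]; ring
    _ ≤ ∫⁻ z in B, ∫⁻ θ in Set.Ioc 0 (2 * Real.pi), F (Complex.exp ((θ : ℝ) * Complex.I) • z) :=
        setLIntegral_mono' Metric.isOpen_ball.measurableSet key
    _ ≤ _ := setLIntegral_le_lintegral _ _

lemma aux_usc {n : ℕ} (D : Set (Fin n → ℂ)) (hDopen : IsOpen D)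
    (φ : (Fin n → ℂ) → EReal) (hφ_lt_top : ∀ z ∈ D, φ z < ⊤)
    (hφ_usc : UpperSemicontinuousOn φ D)
    (p : ℝ) (hp : 0 < p) :
    UpperSemicontinuousOn (fun z => logE (pBergmanKernel D φ p z)) D := by
  intro z₀ hz₀
  obtain ⟨M, hM1, -⟩ := EReal.lt_iff_exists_real_btwn.1 (hφ_lt_top z₀ hz₀)
  have hev : ∀ᶠ z in nhds z₀, z ∈ D ∧ φ z < M := by
    have h1 := hφ_usc z₀ hz₀ M hM1
    rw [hDopen.nhdsWithin_eq hz₀] at h1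
    exact Filter.Eventually.and (hDopen.mem_nhds hz₀) h1
  obtain ⟨ρ, hρ, hball⟩ := Metric.eventually_nhds_iff_ball.1 hev
  set r := ρ / 2 with hr
  have hrpos : 0 < r := by positivity
  set V := volume (Metric.ball (0 : Fin n → ℂ) r) with hV
  have hV0 : V ≠ 0 := (Metric.measure_ball_pos _ _ hrpos).ne'
  have hVt : V ≠ ⊤ := measure_ball_lt_top.ne
  set C : ℝ≥0∞ := ENNReal.ofReal (Real.exp M) / V with hC
  have hCt : C ≠ ⊤ := ENNReal.div_ne_top ENNReal.ofReal_ne_top hV0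
  set b : ℝ := (C ^ p⁻¹).toReal with hb
  have hbound : ∀ f : (Fin n → ℂ) → ℂ, DifferentiableOn ℂ f D → pIntNorm D φ p f = 1 →
      ∀ z ∈ Metric.ball z₀ r, ‖f z‖ ≤ b := by
    intro f hf hf1 z hz
    have hsub : Metric.ball z r ⊆ Metric.ball z₀ ρ := by
      apply Metric.ball_subset_ball'
      have := Metric.mem_ball.1 hz
      linarith
    have h1 := aux_ball (z₀ := z) (r := r) hp (hf.mono fun w hw => (hball w (hsub hw)).1)
    have h2 : ∫⁻ w in Metric.ball z r, (‖f w‖₊ : ℝ≥0∞) ^ p ≤ ENNReal.ofReal (Real.exp M) := by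
      calc _ ≤ ∫⁻ w in Metric.ball z r, ENNReal.ofReal (Real.exp M) *
              ((‖f w‖₊ : ℝ≥0∞) ^ p * expE (-(φ w))) := by
            apply setLIntegral_mono' Metric.isOpen_ball.measurableSet
            intro w hw
            have h3 : (1 : ℝ≥0∞) ≤ ENNReal.ofReal (Real.exp M) * expE (-(φ w)) := by
              have h4 : expE (-(M : EReal)) ≤ expE (-(φ w)) :=
                EReal.exp_monotone (EReal.neg_le_neg_iff.2 (hball w (hsub hw)).2.le)
              have h5 : expE (-(M : EReal)) = ENNReal.ofReal (Real.exp (-M)) := by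
                rw [expE, ← EReal.coe_neg, EReal.exp_coe]
              calc (1 : ℝ≥0∞) = ENNReal.ofReal (Real.exp M) * ENNReal.ofReal (Real.exp (-M)) := by
                    rw [← ENNReal.ofReal_mul (Real.exp_pos _).le, ← Real.exp_add]; simp
                _ ≤ _ := by rw [← h5]; gcongr
            calc (‖f w‖₊ : ℝ≥0∞) ^ p = (‖f w‖₊ : ℝ≥0∞) ^ p * 1 := (mul_one _).symm
              _ ≤ (‖f w‖₊ : ℝ≥0∞) ^ p * (ENNReal.ofReal (Real.exp M) * expE (-(φ w))) := by gcongr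
              _ = _ := by ring
        _ = ENNReal.ofReal (Real.exp M) *
              ∫⁻ w in Metric.ball z r, ((‖f w‖₊ : ℝ≥0∞) ^ p * expE (-(φ w))) :=
            lintegral_const_mul' _ _ ENNReal.ofReal_ne_top
        _ ≤ ENNReal.ofReal (Real.exp M) * pIntNorm D φ p f := by
            gcongr
            exact lintegral_mono_set fun w hw => (hball w (hsub hw)).1
        _ = _ := by rw [hf1, mul_one]
    have h3 : (‖f z‖₊ : ℝ≥0∞) ^ p ≤ C :=
      (ENNReal.le_div_iff_mul_le (Or.inl hV0) (Or.inl hVt)).2 (h1.trans h2)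
    have h4 : (‖f z‖₊ : ℝ≥0∞) ≤ C ^ p⁻¹ := by
      rw [ENNReal.le_rpow_inv_iff hp]; exact h3
    have h5 := ENNReal.toReal_mono (ENNReal.rpow_ne_top_of_nonneg (by positivity) hCt) h4
    simpa using h5
  set S : (Fin n → ℂ) → ℝ≥0∞ := fun z =>
    ⨆ f ∈ {f : (Fin n → ℂ) → ℂ | DifferentiableOn ℂ f D ∧ pIntNorm D φ p f = 1},
      (‖f z‖₊ : ℝ≥0∞) with hS
  have hKS : ∀ z, pBergmanKernel D φ p z = (S z) ^ p := by
    intro z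
    have := (ENNReal.orderIsoRpow p hp).map_iSup₂
      (fun (f : (Fin n → ℂ) → ℂ)
        (_ : f ∈ {f : (Fin n → ℂ) → ℂ | DifferentiableOn ℂ f D ∧ pIntNorm D φ p f = 1}) =>
          (‖f z‖₊ : ℝ≥0∞))
    simp only [ENNReal.orderIsoRpow_apply] at this
    exact this.symm
  have hlip : ∀ z ∈ Metric.ball z₀ r,
      S z ≤ S z₀ + ENNReal.ofReal (2 * b / r * dist z z₀) := by
    intro z hz
    refine iSup₂_le fun f hf => ?_
    have hbd := hbound f hf.1 hf.2
    have hdist : dist (f z) (f z₀) ≤ 2 * b / r * dist z z₀ := by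
      apply Complex.dist_le_div_mul_dist_of_mapsTo_ball _ _ hz
      · exact hf.1.mono fun w hw =>
          (hball w (Metric.ball_subset_ball (by linarith) hw)).1
      · intro w hw
        rw [Metric.mem_closedBall, dist_eq_norm]
        have h1 := hbd w hw
        have h2 := hbd z₀ (Metric.mem_ball_self hrpos)
        have := norm_sub_le (f w) (f z₀)
        linarith
    have h1 : (‖f z‖₊ : ℝ≥0∞) ≤ ‖f z₀‖₊ + ENNReal.ofReal (dist (f z) (f z₀)) := by
      rw [← edist_dist, edist_eq_enorm_sub, ← enorm_eq_nnnorm, ← enorm_eq_nnnorm]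
      calc ‖f z‖ₑ = ‖f z₀ + (f z - f z₀)‖ₑ := by congr 1; ring
        _ ≤ _ := enorm_add_le _ _
    refine h1.trans (add_le_add ?_ (ENNReal.ofReal_le_ofReal hdist))
    exact le_iSup₂ (f := fun (f : (Fin n → ℂ) → ℂ)
        (_ : f ∈ {f : (Fin n → ℂ) → ℂ | DifferentiableOn ℂ f D ∧ pIntNorm D φ p f = 1}) =>
          (‖f z₀‖₊ : ℝ≥0∞)) f hf
  set G : (Fin n → ℂ) → EReal := fun z =>
    ENNReal.log ((S z₀ + ENNReal.ofReal (2 * b / r * dist z z₀)) ^ p) with hG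
  have hGc : Continuous G := by
    refine ENNReal.continuous_log.comp (ENNReal.continuous_rpow_const.comp ?_)
    refine continuous_const.add (ENNReal.continuous_ofReal.comp ?_)
    fun_prop
  have hG0 : G z₀ = logE (pBergmanKernel D φ p z₀) := by
    simp [hG, hKS, logE]
  intro y hy
  have h1 : ∀ᶠ z in nhds z₀, G z < y := by
    apply hGc.continuousAt.eventually_lt_const
    rw [hG0]; exact hy
  apply Filter.Eventually.filter_mono nhdsWithin_le_nhds
  filter_upwards [h1, Metric.ball_mem_nhds z₀ hrpos] with z hz1 hz2
  refine lt_of_le_of_lt ?_ hz1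
  simp only [hKS, logE, hG]
  apply ENNReal.log_monotone
  exact ENNReal.rpow_le_rpow (hlip z hz2) hp.le

lemma toENN_mono {x y : EReal} (h : x ≤ y) : toENN x ≤ toENN y := by
  unfold toENN
  by_cases hy : y = ⊤
  · simp [hy]
  have hx : x ≠ ⊤ := fun hx => hy (top_le_iff.1 (hx ▸ h))
  rw [if_neg hx, if_neg hy]
  by_cases hb : x = ⊥
  · simp [hb]
  exact ENNReal.ofReal_le_ofReal (EReal.toReal_le_toReal h hb hy)

/-- Let `D ⊆ ℂⁿ` be a domain, `φ : D → [-∞, +∞)` upper semicontinuous, and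
`p > 0`. Then `log K_{φ,p}` is a plurisubharmonic function on `D`. -/
theorem statement2 {n : ℕ} (D : Set (Fin n → ℂ)) (hDopen : IsOpen D) (hDconn : IsConnected D)
    (φ : (Fin n → ℂ) → EReal) (hφ_lt_top : ∀ z ∈ D, φ z < ⊤)
    (hφ_usc : UpperSemicontinuousOn φ D)
    (p : ℝ) (hp : 0 < p) :
    PlurisubharmonicOn (fun z => logE (pBergmanKernel D φ p z)) D := by
  have husc := aux_usc D hDopen φ hφ_lt_top hφ_usc p hp
  refine ⟨husc, fun a b => ⟨?_, ?_⟩⟩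
  · intro w hw
    intro y hy
    have hc : Continuous fun w : ℂ => a + w • b := by fun_prop
    have h1 := husc (a + w • b) hw y hy
    exact (hc.continuousWithinAt.tendsto_nhdsWithin (fun x hx => hx)).eventually h1
  · intro c r hr hsub M hM
    set u : ℂ → EReal := fun w => logE (pBergmanKernel D φ p (a + w • b)) with hu
    have hU : IsOpen {w : ℂ | a + w • b ∈ D} :=
      hDopen.preimage (by fun_prop : Continuous fun w : ℂ => a + w • b)
    have key : ∀ f : (Fin n → ℂ) → ℂ, DifferentiableOn ℂ f D → pIntNorm D φ p f = 1 →
        logE ((‖f (a + c • b)‖₊ : ℝ≥0∞) ^ p) + ((circleDeficit u c r M : ℝ≥0∞) : EReal)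
          ≤ (M : EReal) := by
      intro f hf hf1
      have hle : ∀ w : ℂ, logE ((‖f (a + w • b)‖₊ : ℝ≥0∞) ^ p) ≤ u w := by
        intro w
        apply ENNReal.log_monotone
        exact le_iSup₂ (f := fun (f : (Fin n → ℂ) → ℂ)
          (_ : f ∈ {f : (Fin n → ℂ) → ℂ | DifferentiableOn ℂ f D ∧ pIntNorm D φ p f = 1}) =>
          (‖f (a + w • b)‖₊ : ℝ≥0∞) ^ p) f ⟨hf, hf1⟩
      have hd : DifferentiableOn ℂ (fun w : ℂ => f (a + w • b)) {w : ℂ | a + w • b ∈ D} :=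
        hf.comp (by fun_prop) (fun w hw => hw)
      have h := aux_submean hr hp ((hd.analyticOnNhd hU).mono hsub) M
        (fun θ => (hle _).trans (hM θ))
      refine le_trans ?_ h
      refine add_le_add le_rfl ?_
      rw [EReal.coe_ennreal_le_coe_ennreal_iff]
      unfold circleDeficit
      refine ENNReal.div_le_div_right (lintegral_mono fun θ => ?_) _
      apply toENN_mono
      exact EReal.sub_le_sub le_rfl (hle _)
    set d := circleDeficit u c r M with hd
    change u c + (d : EReal) ≤ M
    by_cases hdt : d = ⊤
    · have : u c = ⊥ := by
        rw [hu]
        simp only [logE, ENNReal.log_eq_bot_iff, pBergmanKernel]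
        rw [← le_zero_iff]
        refine iSup₂_le fun f hf => ?_
        by_contra hne
        have h := key f hf.1 hf.2
        rw [hdt, EReal.coe_ennreal_top, EReal.add_top_of_ne_bot] at h
        · exact absurd h (by simp)
        · rw [logE, Ne, ENNReal.log_eq_bot_iff]
          simpa using hne
      rw [this, EReal.bot_add]
      exact bot_le
    · have hd1 : (d : EReal) ≠ ⊤ := by simpa using hdt
      have hd2 : (d : EReal) ≠ ⊥ := by simp
      rw [← EReal.le_sub_iff_add_le (Or.inl hd2) (Or.inl hd1)]
      have : u c = ENNReal.logOrderIso (pBergmanKernel D φ p (a + c • b)) := rfl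
      rw [this, pBergmanKernel, OrderIso.map_iSup₂]
      refine iSup₂_le fun f hf => ?_
      rw [EReal.le_sub_iff_add_le (Or.inl hd2) (Or.inl hd1)]
      exact key f hf.1 hf.2
end
end

section
/- Let Ω₁ ⊆ ℂⁿ and Ω₂ ⊆ ℂ^s be domains and φ₁, φ₂ upper semicontinuous functions on Ω₁ and Ω₂ respectively. Let K_{m,1}, K_{m,2}, K_m be the m-Bergman kernels of H_m(Ω₁, φ₁), H_m(Ω₂, φ₂), and H_m(Ω₁×Ω₂, φ₁(z₁)+φ₂(z₂)) respectively. Then for every point (x₁, x₂) ∈ Ω₁×Ω₂ one has K_m(x₁,x₂) = K_{m,1}(x₁)·K_{m,2}(x₂). -/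
open MeasureTheory Complex Set
open scoped ENNReal NNReal

noncomputable section

/-- The `m`-norm `‖u‖_m = (∫_Ω |u|^{2/m} e^{-φ/m} dλ)^{m/2}` of the weighted `m`-Bergman space. -/
def mNorm {E : Type*} [NormedAddCommGroup E] [NormedSpace ℂ E] [MeasureSpace E]
    (Ω : Set E) (φ : E → EReal) (m : ℕ) (u : E → ℂ) : ℝ≥0∞ :=
  (∫⁻ z in Ω, (‖u z‖₊ : ℝ≥0∞) ^ (2 / (m : ℝ)) * expE (-(φ z) * (((m : ℝ)⁻¹ : ℝ) : EReal))) ^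
    ((m : ℝ) / 2)

/-- The `m`-Bergman kernel `K_m(x) = sup { |u(x)|² / ‖u‖_m² : u ∈ H_m(Ω,φ) }` (with the
convention `0/0 = 0`, so that `K_m(x) = 0` if every `u ∈ H_m(Ω,φ)` vanishes at `x`). -/
def mBergmanKernel {E : Type*} [NormedAddCommGroup E] [NormedSpace ℂ E] [MeasureSpace E]
    (Ω : Set E) (φ : E → EReal) (m : ℕ) (x : E) : ℝ≥0∞ :=
  ⨆ u ∈ {u : E → ℂ | DifferentiableOn ℂ u Ω ∧ mNorm Ω φ m u < ⊤},
    ((‖u x‖₊ : ℝ≥0∞) ^ 2) / (mNorm Ω φ m u) ^ 2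

/-- The weight `e^{-φ/m}`. -/
def wgt {E : Type*} (φ : E → EReal) (m : ℕ) (z : E) : ℝ≥0∞ :=
  expE (-(φ z) * (((m : ℝ)⁻¹ : ℝ) : EReal))

/-- The integral `∫_Ω |u|^{2/m} e^{-φ/m}`. -/
def mInt {E : Type*} [MeasureSpace E]
    (Ω : Set E) (φ : E → EReal) (m : ℕ) (u : E → ℂ) : ℝ≥0∞ :=
  ∫⁻ z in Ω, (‖u z‖₊ : ℝ≥0∞) ^ (2 / (m : ℝ)) * wgt φ m z

lemma wgt_antitone (m : ℕ) :
    Antitone (fun x : EReal => expE (-x * (((m : ℝ)⁻¹ : ℝ) : EReal))) := by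
  intro x y hxy
  apply EReal.exp_monotone
  apply mul_le_mul_of_nonneg_right (EReal.neg_le_neg_iff.2 hxy)
  exact_mod_cast inv_nonneg.2 (Nat.cast_nonneg m)

lemma wgt_aemeasurable {E : Type*} [TopologicalSpace E] [MeasureSpace E] [BorelSpace E]
    {Ω : Set E} (hΩ : IsOpen Ω) {φ : E → EReal} (h : UpperSemicontinuousOn φ Ω) (m : ℕ) :
    AEMeasurable (wgt φ m) (volume.restrict Ω) := by
  apply aemeasurable_restrict_of_measurable_subtype hΩ.measurableSet
  have h1 : Measurable (Ω.domRestrict φ) :=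
    (upperSemicontinuousOn_iff_restrict.2 h).measurable
  exact (wgt_antitone m).measurable.comp h1

lemma wgt_ne_zero {E : Type*} {φ : E → EReal} {m : ℕ} (hm : 1 ≤ m) {z : E} (h : φ z < ⊤) :
    wgt φ m z ≠ 0 := by
  have hm' : (0 : ℝ) < (m : ℝ)⁻¹ := by positivity
  unfold wgt expE
  rw [Ne, EReal.exp_eq_zero_iff]
  generalize φ z = x at h
  induction x with
  | bot => simp [EReal.top_mul_coe_of_pos hm']
  | top => simp at h
  | coe x =>
    rw [← EReal.coe_neg, ← EReal.coe_mul]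
    exact EReal.coe_ne_bot _

lemma wgt_add {E F : Type*} {φ : E → EReal} {ψ : F → EReal} {m : ℕ} {z : E} {w : F}
    (h : φ z < ⊤) (h' : ψ w < ⊤) :
    wgt (fun p : E × F => φ p.1 + ψ p.2) m (z, w) = wgt φ m z * wgt ψ m w := by
  unfold wgt expE
  rw [← EReal.exp_add]
  simp only
  rw [EReal.neg_add (Or.inr h'.ne) (Or.inl h.ne), sub_eq_add_neg,
    EReal.right_distrib_of_nonneg_of_ne_top _ (EReal.coe_ne_top _)]
  exact_mod_cast inv_nonneg.2 (Nat.cast_nonneg m)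

section one
variable {E : Type*} [NormedAddCommGroup E] [NormedSpace ℂ E] [MeasureSpace E]

lemma mNorm_sq (Ω : Set E) (φ : E → EReal) (m : ℕ) (u : E → ℂ) :
    mNorm Ω φ m u ^ 2 = mInt Ω φ m u ^ (m : ℝ) := by
  change (mInt Ω φ m u ^ ((m : ℝ) / 2)) ^ 2 = _
  rw [← ENNReal.rpow_natCast, ← ENNReal.rpow_mul]
  norm_num

lemma mNorm_lt_top {Ω : Set E} {φ : E → EReal} {m : ℕ} (hm : 1 ≤ m) {u : E → ℂ} :
    mNorm Ω φ m u < ⊤ ↔ mInt Ω φ m u < ⊤ := by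
  have hm' : (0 : ℝ) < (m : ℝ) / 2 := by positivity
  exact ENNReal.rpow_lt_top_iff_of_pos hm'

variable [BorelSpace E]

lemma integrand_aemeasurable {Ω : Set E} (hΩ : IsOpen Ω) {φ : E → EReal}
    (h : UpperSemicontinuousOn φ Ω) (m : ℕ) {u : E → ℂ} (hu : ContinuousOn u Ω) :
    AEMeasurable (fun z => (‖u z‖₊ : ℝ≥0∞) ^ (2 / (m : ℝ)) * wgt φ m z)
      (volume.restrict Ω) := by
  have := wgt_aemeasurable hΩ h m
  have h2 := hu.aemeasurable hΩ.measurableSet (μ := volume)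
  exact (h2.nnnorm.coe_nnreal_ennreal.pow_const _).mul this

variable [(volume : Measure E).IsOpenPosMeasure]

lemma eq_zero_of_mInt {Ω : Set E} (hΩ : IsOpen Ω) {φ : E → EReal}
    (h : UpperSemicontinuousOn φ Ω) (ht : ∀ z ∈ Ω, φ z < ⊤) {m : ℕ} (hm : 1 ≤ m)
    {u : E → ℂ} (hu : ContinuousOn u Ω) (h0 : mInt Ω φ m u = 0) {x : E} (hx : x ∈ Ω) :
    u x = 0 := by
  have hm' : (0 : ℝ) < 2 / (m : ℝ) := by positivity
  have h1 := (lintegral_eq_zero_iff' (integrand_aemeasurable hΩ h m hu)).1 h0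
  have h2 : u =ᵐ[volume.restrict Ω] (fun _ => 0) := by
    filter_upwards [h1, ae_restrict_mem hΩ.measurableSet] with z hz hzΩ
    rcases mul_eq_zero.1 hz with h3 | h3
    · rw [ENNReal.rpow_eq_zero_iff_of_pos hm'] at h3
      simpa using h3
    · exact absurd h3 (wgt_ne_zero hm (ht z hzΩ))
  exact Measure.eqOn_open_of_ae_eq h2 hΩ hu continuousOn_const hx

lemma key1 {Ω : Set E} (hΩ : IsOpen Ω) {φ : E → EReal}
    (h : UpperSemicontinuousOn φ Ω) (ht : ∀ z ∈ Ω, φ z < ⊤) {m : ℕ} (hm : 1 ≤ m)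
    {u : E → ℂ} (hu : DifferentiableOn ℂ u Ω) (hI : mInt Ω φ m u < ⊤) {x : E} (hx : x ∈ Ω) :
    (‖u x‖₊ : ℝ≥0∞) ^ (2 / (m : ℝ)) ≤
      mBergmanKernel Ω φ m x ^ ((m : ℝ)⁻¹) * mInt Ω φ m u := by
  have hm0 : (0 : ℝ) < (m : ℝ) := by positivity
  have hm' : (0 : ℝ) < 2 / (m : ℝ) := by positivity
  by_cases h0 : mInt Ω φ m u = 0
  · rw [eq_zero_of_mInt hΩ h ht hm hu.continuousOn h0 hx]
    simp [hm0]
  have h1 : (‖u x‖₊ : ℝ≥0∞) ^ 2 / mNorm Ω φ m u ^ 2 ≤ mBergmanKernel Ω φ m x := by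
    unfold mBergmanKernel
    exact le_iSup₂ (f := fun (u : E → ℂ)
      (_ : u ∈ {u : E → ℂ | DifferentiableOn ℂ u Ω ∧ mNorm Ω φ m u < ⊤}) =>
        (‖u x‖₊ : ℝ≥0∞) ^ 2 / mNorm Ω φ m u ^ 2) u ⟨hu, (mNorm_lt_top hm).2 hI⟩
  rw [mNorm_sq, ENNReal.div_le_iff] at h1
  · have h2 := ENNReal.rpow_le_rpow h1 (inv_nonneg.2 hm0.le)
    rw [ENNReal.mul_rpow_of_nonneg _ _ (inv_nonneg.2 hm0.le), ENNReal.rpow_rpow_inv hm0.ne',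
      ← ENNReal.rpow_natCast, ← ENNReal.rpow_mul] at h2
    simpa [div_eq_mul_inv] using h2
  · simp [ENNReal.rpow_eq_zero_iff, h0, hI.ne]
  · exact (ENNReal.rpow_lt_top_of_nonneg hm0.le hI.ne).ne

end one

section two
variable {E : Type*} [NormedAddCommGroup E] [NormedSpace ℂ E] [MeasureSpace E] [BorelSpace E]
  [SecondCountableTopology E] [(volume : Measure E).IsOpenPosMeasure]
  [SigmaFinite (volume : Measure E)]
variable {F : Type*} [NormedAddCommGroup F] [NormedSpace ℂ F] [MeasureSpace F] [BorelSpace F]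
  [SecondCountableTopology F] [(volume : Measure F).IsOpenPosMeasure]
  [SigmaFinite (volume : Measure F)]

lemma prod_integrand_ae {Ω₁ : Set E} {Ω₂ : Set F} (h₁ : IsOpen Ω₁) (h₂ : IsOpen Ω₂)
    {φ₁ : E → EReal} {φ₂ : F → EReal}
    (t₁ : ∀ z ∈ Ω₁, φ₁ z < ⊤) (t₂ : ∀ z ∈ Ω₂, φ₂ z < ⊤) (m : ℕ) :
    (wgt (fun z : E × F => φ₁ z.1 + φ₂ z.2) m) =ᵐ[
      ((volume : Measure E).restrict Ω₁).prod ((volume : Measure F).restrict Ω₂)]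
      fun z => wgt φ₁ m z.1 * wgt φ₂ m z.2 := by
  rw [Measure.prod_restrict]
  filter_upwards [ae_restrict_mem (h₁.prod h₂).measurableSet] with z hz
  exact wgt_add (t₁ _ hz.1) (t₂ _ hz.2)

lemma mInt_prod {Ω₁ : Set E} {Ω₂ : Set F} (h₁ : IsOpen Ω₁) (h₂ : IsOpen Ω₂)
    {φ₁ : E → EReal} {φ₂ : F → EReal}
    (t₁ : ∀ z ∈ Ω₁, φ₁ z < ⊤) (t₂ : ∀ z ∈ Ω₂, φ₂ z < ⊤) (m : ℕ) (u : E × F → ℂ) :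
    mInt (Ω₁ ×ˢ Ω₂) (fun z => φ₁ z.1 + φ₂ z.2) m u =
      ∫⁻ z, (‖u z‖₊ : ℝ≥0∞) ^ (2 / (m : ℝ)) * (wgt φ₁ m z.1 * wgt φ₂ m z.2) ∂
        (((volume : Measure E).restrict Ω₁).prod ((volume : Measure F).restrict Ω₂)) := by
  have := prod_integrand_ae h₁ h₂ t₁ t₂ m
  unfold mInt
  rw [Measure.volume_eq_prod, ← Measure.prod_restrict]
  apply lintegral_congr_ae
  filter_upwards [this] with z hz
  rw [hz]

lemma mInt_swap {Ω₁ : Set E} {Ω₂ : Set F} (h₁ : IsOpen Ω₁) (h₂ : IsOpen Ω₂)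
    {φ₁ : E → EReal} {φ₂ : F → EReal}
    (t₁ : ∀ z ∈ Ω₁, φ₁ z < ⊤) (t₂ : ∀ z ∈ Ω₂, φ₂ z < ⊤) (m : ℕ) (u : E × F → ℂ) :
    mInt (Ω₂ ×ˢ Ω₁) (fun z => φ₂ z.1 + φ₁ z.2) m (fun z => u z.swap) =
    mInt (Ω₁ ×ˢ Ω₂) (fun z => φ₁ z.1 + φ₂ z.2) m u := by
  rw [mInt_prod h₁ h₂ t₁ t₂, mInt_prod h₂ h₁ t₂ t₁, ← lintegral_prod_swap]
  simp only [Prod.fst_swap, Prod.snd_swap, Prod.swap_swap, mul_comm]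

lemma mInt_tensor {Ω₁ : Set E} {Ω₂ : Set F} (h₁ : IsOpen Ω₁) (h₂ : IsOpen Ω₂)
    {φ₁ : E → EReal} {φ₂ : F → EReal}
    (c₁ : UpperSemicontinuousOn φ₁ Ω₁) (c₂ : UpperSemicontinuousOn φ₂ Ω₂)
    (t₁ : ∀ z ∈ Ω₁, φ₁ z < ⊤) (t₂ : ∀ z ∈ Ω₂, φ₂ z < ⊤) (m : ℕ)
    {u : E → ℂ} {v : F → ℂ} (hu : ContinuousOn u Ω₁) (hv : ContinuousOn v Ω₂) :
    mInt (Ω₁ ×ˢ Ω₂) (fun z => φ₁ z.1 + φ₂ z.2) m (fun z => u z.1 * v z.2) =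
      mInt Ω₁ φ₁ m u * mInt Ω₂ φ₂ m v := by
  rw [mInt_prod h₁ h₂ t₁ t₂]
  unfold mInt
  rw [← lintegral_prod_mul (integrand_aemeasurable h₁ c₁ m hu)
    (integrand_aemeasurable h₂ c₂ m hv)]
  congr 1
  ext z
  rw [nnnorm_mul, ENNReal.coe_mul, ENNReal.mul_rpow_of_nonneg _ _ (by positivity)]
  ring

lemma prod_aemeasurable {Ω₁ : Set E} {Ω₂ : Set F} (h₁ : IsOpen Ω₁) (h₂ : IsOpen Ω₂)
    {φ₁ : E → EReal} {φ₂ : F → EReal}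
    (c₁ : UpperSemicontinuousOn φ₁ Ω₁) (c₂ : UpperSemicontinuousOn φ₂ Ω₂) (m : ℕ)
    {u : E × F → ℂ} (hu : ContinuousOn u (Ω₁ ×ˢ Ω₂)) :
    AEMeasurable (fun z => (‖u z‖₊ : ℝ≥0∞) ^ (2 / (m : ℝ)) * (wgt φ₁ m z.1 * wgt φ₂ m z.2))
      (((volume : Measure E).restrict Ω₁).prod ((volume : Measure F).restrict Ω₂)) := by
  have a1 := (wgt_aemeasurable h₁ c₁ m).comp_fst (ν := (volume : Measure F).restrict Ω₂)
  have a2 := (wgt_aemeasurable h₂ c₂ m).comp_snd (μ := (volume : Measure E).restrict Ω₁)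
  have a3 : AEMeasurable u
      (((volume : Measure E).restrict Ω₁).prod ((volume : Measure F).restrict Ω₂)) := by
    rw [Measure.prod_restrict]
    exact hu.aemeasurable (h₁.prod h₂).measurableSet
  exact (a3.nnnorm.coe_nnreal_ennreal.pow_const _).mul (a1.mul a2)

lemma slice {Ω₁ : Set E} {Ω₂ : Set F} (h₁ : IsOpen Ω₁) (h₂ : IsOpen Ω₂)
    {φ₁ : E → EReal} {φ₂ : F → EReal}
    (c₁ : UpperSemicontinuousOn φ₁ Ω₁) (c₂ : UpperSemicontinuousOn φ₂ Ω₂)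
    (t₁ : ∀ z ∈ Ω₁, φ₁ z < ⊤) (t₂ : ∀ z ∈ Ω₂, φ₂ z < ⊤) {m : ℕ} (hm : 1 ≤ m)
    {u : E × F → ℂ} (hu : DifferentiableOn ℂ u (Ω₁ ×ˢ Ω₂))
    (hI : mInt (Ω₁ ×ˢ Ω₂) (fun z => φ₁ z.1 + φ₂ z.2) m u < ⊤) {x : E} (hx : x ∈ Ω₁) :
    (∀ᵐ w ∂((volume : Measure F).restrict Ω₂), (‖u (x, w)‖₊ : ℝ≥0∞) ^ (2 / (m : ℝ)) ≤
      mBergmanKernel Ω₁ φ₁ m x ^ ((m : ℝ)⁻¹) * mInt Ω₁ φ₁ m (fun z => u (z, w))) ∧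
    mInt Ω₂ φ₂ m (fun w => u (x, w)) ≤ mBergmanKernel Ω₁ φ₁ m x ^ ((m : ℝ)⁻¹) *
      mInt (Ω₁ ×ˢ Ω₂) (fun z => φ₁ z.1 + φ₂ z.2) m u := by
  have hM := prod_aemeasurable h₁ h₂ c₁ c₂ m hu.continuousOn
  have hd : ∀ w ∈ Ω₂, DifferentiableOn ℂ (fun z => u (z, w)) Ω₁ := fun w hw =>
    hu.comp (by fun_prop) (fun z hz => ⟨hz, hw⟩)
  have hin : ∀ w ∈ Ω₂, ∫⁻ z in Ω₁, (‖u (z, w)‖₊ : ℝ≥0∞) ^ (2 / (m : ℝ)) *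
      (wgt φ₁ m z * wgt φ₂ m w) = mInt Ω₁ φ₁ m (fun z => u (z, w)) * wgt φ₂ m w := by
    intro w hw
    unfold mInt
    rw [← lintegral_mul_const'' _ (integrand_aemeasurable h₁ c₁ m (hd w hw).continuousOn)]
    simp only [mul_assoc]
  have hE : mInt (Ω₁ ×ˢ Ω₂) (fun z => φ₁ z.1 + φ₂ z.2) m u =
      ∫⁻ w in Ω₂, ∫⁻ z in Ω₁, (‖u (z, w)‖₊ : ℝ≥0∞) ^ (2 / (m : ℝ)) *
      (wgt φ₁ m z * wgt φ₂ m w) := by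
    rw [mInt_prod h₁ h₂ t₁ t₂, lintegral_prod_symm _ hM]
  have hM2 : AEMeasurable (fun w => ∫⁻ z in Ω₁, (‖u (z, w)‖₊ : ℝ≥0∞) ^ (2 / (m : ℝ)) *
      (wgt φ₁ m z * wgt φ₂ m w)) ((volume : Measure F).restrict Ω₂) :=
    hM.prod_swap.lintegral_prod_right'
  have hfin := ae_lt_top' hM2 (hE ▸ hI.ne)
  have hA : ∀ᵐ w ∂((volume : Measure F).restrict Ω₂), (‖u (x, w)‖₊ : ℝ≥0∞) ^ (2 / (m : ℝ)) ≤
      mBergmanKernel Ω₁ φ₁ m x ^ ((m : ℝ)⁻¹) * mInt Ω₁ φ₁ m (fun z => u (z, w)) := by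
    filter_upwards [hfin, ae_restrict_mem h₂.measurableSet] with w hw hwΩ
    rw [hin w hwΩ] at hw
    refine key1 h₁ c₁ t₁ hm (hd w hwΩ) ?_ hx
    by_contra hcon
    rw [not_lt, top_le_iff] at hcon
    rw [hcon, ENNReal.top_mul (wgt_ne_zero hm (t₂ w hwΩ))] at hw
    exact lt_irrefl _ hw
  refine ⟨hA, ?_⟩
  rw [hE, ← lintegral_const_mul'' _ hM2]
  apply lintegral_mono_ae
  filter_upwards [hA, ae_restrict_mem h₂.measurableSet] with w hw hwΩ
  rw [hin w hwΩ, ← mul_assoc]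
  gcongr

lemma point_bound_aux {Ω₁ : Set E} {Ω₂ : Set F} (h₁ : IsOpen Ω₁) (h₂ : IsOpen Ω₂)
    {φ₁ : E → EReal} {φ₂ : F → EReal}
    (c₁ : UpperSemicontinuousOn φ₁ Ω₁) (c₂ : UpperSemicontinuousOn φ₂ Ω₂)
    (t₁ : ∀ z ∈ Ω₁, φ₁ z < ⊤) (t₂ : ∀ z ∈ Ω₂, φ₂ z < ⊤) {m : ℕ} (hm : 1 ≤ m)
    {u : E × F → ℂ} (hu : DifferentiableOn ℂ u (Ω₁ ×ˢ Ω₂))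
    (hI : mInt (Ω₁ ×ˢ Ω₂) (fun z => φ₁ z.1 + φ₂ z.2) m u < ⊤) {x : E} (hx : x ∈ Ω₁)
    {y : F} (hy : y ∈ Ω₂) (hK : mBergmanKernel Ω₁ φ₁ m x ≠ ⊤) :
    (‖u (x, y)‖₊ : ℝ≥0∞) ^ 2 ≤ mBergmanKernel Ω₁ φ₁ m x * mBergmanKernel Ω₂ φ₂ m y *
      mNorm (Ω₁ ×ˢ Ω₂) (fun z => φ₁ z.1 + φ₂ z.2) m u ^ 2 := by
  have hm0 : (0 : ℝ) < (m : ℝ) := by positivity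
  have hs := (slice h₁ h₂ c₁ c₂ t₁ t₂ hm hu hI hx).2
  have hd : DifferentiableOn ℂ (fun w => u (x, w)) Ω₂ :=
    hu.comp (by fun_prop) (fun z hz => ⟨hx, hz⟩)
  have hlt : mInt Ω₂ φ₂ m (fun w => u (x, w)) < ⊤ :=
    hs.trans_lt (ENNReal.mul_lt_top
      (ENNReal.rpow_lt_top_of_nonneg (inv_nonneg.2 hm0.le) hK) hI)
  have h3 := key1 h₂ c₂ t₂ hm hd hlt hy
  have h4 := ENNReal.rpow_le_rpow (h3.trans (mul_le_mul_right hs _)) hm0.le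
  rw [ENNReal.mul_rpow_of_nonneg _ _ hm0.le, ENNReal.mul_rpow_of_nonneg _ _ hm0.le,
    ENNReal.rpow_inv_rpow hm0.ne', ENNReal.rpow_inv_rpow hm0.ne', ← ENNReal.rpow_mul,
    div_mul_cancel₀ _ hm0.ne', ← mNorm_sq, ← mul_assoc] at h4
  rw [mul_comm (mBergmanKernel Ω₁ φ₁ m x)]
  exact_mod_cast h4

lemma kernel_le {Ω₁ : Set E} {Ω₂ : Set F} (h₁ : IsOpen Ω₁) (h₂ : IsOpen Ω₂)
    {φ₁ : E → EReal} {φ₂ : F → EReal}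
    (c₁ : UpperSemicontinuousOn φ₁ Ω₁) (c₂ : UpperSemicontinuousOn φ₂ Ω₂)
    (t₁ : ∀ z ∈ Ω₁, φ₁ z < ⊤) (t₂ : ∀ z ∈ Ω₂, φ₂ z < ⊤) {m : ℕ} (hm : 1 ≤ m)
    {x : E} (hx : x ∈ Ω₁) {y : F} (hy : y ∈ Ω₂) :
    mBergmanKernel (Ω₁ ×ˢ Ω₂) (fun z => φ₁ z.1 + φ₂ z.2) m (x, y) ≤
      mBergmanKernel Ω₁ φ₁ m x * mBergmanKernel Ω₂ φ₂ m y := by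
  refine iSup₂_le fun u hu => ?_
  obtain ⟨hu, hN⟩ := hu
  have hI := (mNorm_lt_top hm).1 hN
  apply ENNReal.div_le_of_le_mul
  by_cases hK : mBergmanKernel Ω₁ φ₁ m x ≠ ⊤
  · exact point_bound_aux h₁ h₂ c₁ c₂ t₁ t₂ hm hu hI hx hy hK
  by_cases hK2 : mBergmanKernel Ω₂ φ₂ m y ≠ ⊤
  · have hu' : DifferentiableOn ℂ (fun z : F × E => u z.swap) (Ω₂ ×ˢ Ω₁) :=
      hu.comp (f := fun z : F × E => (z.2, z.1)) (by fun_prop) (fun z hz => ⟨hz.2, hz.1⟩)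
    have hs := mInt_swap h₁ h₂ t₁ t₂ m u
    have := point_bound_aux h₂ h₁ c₂ c₁ t₂ t₁ hm hu' (hs ▸ hI) hy hx hK2
    rw [mNorm_sq, hs, ← mNorm_sq, mul_comm (mBergmanKernel Ω₂ φ₂ m y)] at this
    exact this
  simp only [ne_eq, not_not] at hK hK2
  rw [hK, hK2]
  by_cases h0 : mNorm (Ω₁ ×ˢ Ω₂) (fun z => φ₁ z.1 + φ₂ z.2) m u = 0
  · have h0' : mInt (Ω₁ ×ˢ Ω₂) (fun z => φ₁ z.1 + φ₂ z.2) m u = 0 := by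
      have := mNorm_sq (Ω₁ ×ˢ Ω₂) (fun z => φ₁ z.1 + φ₂ z.2) m u
      rw [h0] at this
      have hm0 : (0 : ℝ) < (m : ℝ) := by positivity
      rw [zero_pow two_ne_zero, eq_comm, ENNReal.rpow_eq_zero_iff_of_pos hm0] at this
      exact this
    have hs := (slice h₁ h₂ c₁ c₂ t₁ t₂ hm hu hI hx).2
    rw [h0', mul_zero, nonpos_iff_eq_zero] at hs
    have hd : DifferentiableOn ℂ (fun w => u (x, w)) Ω₂ :=
      hu.comp (by fun_prop) (fun z hz => ⟨hx, hz⟩)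
    have := eq_zero_of_mInt h₂ c₂ t₂ hm hd.continuousOn hs hy
    simp [this]
  · simp [h0, ENNReal.top_mul]

lemma kernel_ge {Ω₁ : Set E} {Ω₂ : Set F} (h₁ : IsOpen Ω₁) (h₂ : IsOpen Ω₂)
    {φ₁ : E → EReal} {φ₂ : F → EReal}
    (c₁ : UpperSemicontinuousOn φ₁ Ω₁) (c₂ : UpperSemicontinuousOn φ₂ Ω₂)
    (t₁ : ∀ z ∈ Ω₁, φ₁ z < ⊤) (t₂ : ∀ z ∈ Ω₂, φ₂ z < ⊤) {m : ℕ} (hm : 1 ≤ m)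
    {x : E} {y : F} :
    mBergmanKernel Ω₁ φ₁ m x * mBergmanKernel Ω₂ φ₂ m y ≤
      mBergmanKernel (Ω₁ ×ˢ Ω₂) (fun z => φ₁ z.1 + φ₂ z.2) m (x, y) := by
  have hm0 : (0 : ℝ) < (m : ℝ) := by positivity
  conv_lhs => unfold mBergmanKernel
  simp only [ENNReal.iSup_mul, ENNReal.mul_iSup]
  refine iSup₂_le fun v hv => iSup₂_le fun u hu => ?_
  obtain ⟨hu, hNu⟩ := hu
  obtain ⟨hv, hNv⟩ := hv
  have hIu := (mNorm_lt_top hm).1 hNu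
  have hIv := (mNorm_lt_top hm).1 hNv
  have hT := mInt_tensor h₁ h₂ c₁ c₂ t₁ t₂ m hu.continuousOn hv.continuousOn
  have hd : DifferentiableOn ℂ (fun z : E × F => u z.1 * v z.2) (Ω₁ ×ˢ Ω₂) :=
    (hu.comp differentiableOn_fst (fun z hz => hz.1)).mul
      (hv.comp differentiableOn_snd (fun z hz => hz.2))
  refine le_trans ?_ (le_iSup₂ (f := fun (u : E × F → ℂ)
      (_ : u ∈ {u : E × F → ℂ | DifferentiableOn ℂ u (Ω₁ ×ˢ Ω₂) ∧
        mNorm (Ω₁ ×ˢ Ω₂) (fun z => φ₁ z.1 + φ₂ z.2) m u < ⊤}) =>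
        (‖u (x, y)‖₊ : ℝ≥0∞) ^ 2 / mNorm (Ω₁ ×ˢ Ω₂) (fun z => φ₁ z.1 + φ₂ z.2) m u ^ 2)
      (fun z : E × F => u z.1 * v z.2)
      ⟨hd, (mNorm_lt_top hm).2 (hT ▸ ENNReal.mul_lt_top hIu hIv)⟩)
  simp only [mNorm_sq, hT]
  rw [ENNReal.mul_rpow_of_nonneg _ _ hm0.le, nnnorm_mul, ENNReal.coe_mul, mul_pow,
    div_eq_mul_inv, div_eq_mul_inv, div_eq_mul_inv, ENNReal.mul_inv
      (Or.inr (ENNReal.rpow_lt_top_of_nonneg hm0.le hIv.ne).ne)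
      (Or.inl (ENNReal.rpow_lt_top_of_nonneg hm0.le hIu.ne).ne)]
  apply le_of_eq
  ring

end two

/-- Product property of `m`-Bergman kernels: for domains `Ω₁ ⊆ ℂⁿ`, `Ω₂ ⊆ ℂˢ`
with upper semicontinuous weights `φ₁, φ₂`, one has
`K_m((x₁,x₂)) = K_{m,1}(x₁) · K_{m,2}(x₂)` for every `(x₁,x₂) ∈ Ω₁ × Ω₂`, where `K_m` is the
`m`-Bergman kernel of `H_m(Ω₁ × Ω₂, φ₁(z₁) + φ₂(z₂))`. -/
theorem statement7 {n s : ℕ} (Ω₁ : Set (Fin n → ℂ)) (Ω₂ : Set (Fin s → ℂ))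
    (h₁open : IsOpen Ω₁) (h₁conn : IsConnected Ω₁)
    (h₂open : IsOpen Ω₂) (h₂conn : IsConnected Ω₂)
    (φ₁ : (Fin n → ℂ) → EReal) (φ₂ : (Fin s → ℂ) → EReal)
    (h₁usc : UpperSemicontinuousOn φ₁ Ω₁) (h₁top : ∀ z ∈ Ω₁, φ₁ z < ⊤)
    (h₂usc : UpperSemicontinuousOn φ₂ Ω₂) (h₂top : ∀ z ∈ Ω₂, φ₂ z < ⊤)
    (m : ℕ) (hm : 1 ≤ m) (x₁ : Fin n → ℂ) (x₂ : Fin s → ℂ) (hx₁ : x₁ ∈ Ω₁) (hx₂ : x₂ ∈ Ω₂) :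
    mBergmanKernel (Ω₁ ×ˢ Ω₂) (fun z => φ₁ z.1 + φ₂ z.2) m (x₁, x₂) =
      mBergmanKernel Ω₁ φ₁ m x₁ * mBergmanKernel Ω₂ φ₂ m x₂ := by
  exact le_antisymm
    (kernel_le h₁open h₂open h₁usc h₂usc h₁top h₂top hm hx₁ hx₂)
    (kernel_ge h₁open h₂open h₁usc h₂usc h₁top h₂top hm)
end
end
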